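/- (Enstrophy, uniform-in-time bound.) Let 0<L_s≤∞ and suppose ‖u₀‖_{W^{1,4}}<∞. There exists a constant C=C(Γ)>0 such that every classical solution of the Boussinesq system with 0≤T₀≤1 satisfies ‖ω(t)‖_{L⁴} ≤ C·max{1, L_s^{−3}}·(‖u₀‖_{W^{1,4}} + Ra) for all t≥0, where ω=∂₁u₂−∂₂u₁ is the vorticity. -/

import Mathlib

noncomputable section
open MeasureTheory Filter Set
open scoped ENNReal

namespace RB

/-- A time-dependent scalar field: arguments t, x₁, x₂. -/
abbrev TField := ℝ → ℝ → ℝ → ℝ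
/-- A static scalar field: arguments x₁, x₂. -/
abbrev SField := ℝ → ℝ → ℝ

def tsmooth (f : TField) : Prop :=
  ContDiff ℝ (⊤ : ℕ∞) (fun q : ℝ × ℝ × ℝ => f q.1 q.2.1 q.2.2)
def ssmooth (f : SField) : Prop :=
  ContDiff ℝ (⊤ : ℕ∞) (fun q : ℝ × ℝ => f q.1 q.2)
def tperiodic (Γ : ℝ) (f : TField) : Prop := ∀ t x1 x2, f t (x1 + Γ) x2 = f t x1 x2
def speriodic (Γ : ℝ) (f : SField) : Prop := ∀ x1 x2, f (x1 + Γ) x2 = f x1 x2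

/-- time derivative -/
def dt (f : TField) : TField := fun t x1 x2 => deriv (fun s => f s x1 x2) t
/-- partial derivative in x₁ (time-dependent field) -/
def d1 (f : TField) : TField := fun t x1 x2 => deriv (fun y => f t y x2) x1
/-- partial derivative in x₂ (time-dependent field) -/
def d2 (f : TField) : TField := fun t x1 x2 => deriv (fun y => f t x1 y) x2
/-- partial derivative in x₁ (static field) -/
def q1 (f : SField) : SField := fun x1 x2 => deriv (fun y => f y x2) x1
/-- partial derivative in x₂ (static field) -/
def q2 (f : SField) : SField := fun x1 x2 => deriv (fun y => f x1 y) x2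

/-- Integral over Ω = [0,Γ]×[0,1]. -/
def intΩ (Γ : ℝ) (g : SField) : ℝ :=
  ∫ x1 in Ioc (0:ℝ) Γ, ∫ x2 in Ioc (0:ℝ) 1, g x1 x2

/-- Long-time horizontal average ⟨f⟩ of a quantity f(t, x₁). -/
def ltavg (Γ : ℝ) (f : ℝ → ℝ → ℝ) : ℝ :=
  limsup (fun t => (1/t) * ∫ s in Ioc (0:ℝ) t, (1/Γ) * ∫ x1 in Ioc (0:ℝ) Γ, f s x1) atTop

/-- spatial L² norm of a static scalar field over Ω -/
def sL2 (Γ : ℝ) (f : SField) : ℝ := Real.sqrt (intΩ Γ (fun x1 x2 => f x1 x2 ^ 2))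
/-- spatial L^r norm of a static scalar field over Ω -/
def sLr (Γ r : ℝ) (f : SField) : ℝ := (intΩ Γ (fun x1 x2 => |f x1 x2| ^ r)) ^ (1/r)
/-- H¹ norm of a static scalar field over Ω -/
def sH1 (Γ : ℝ) (f : SField) : ℝ :=
  Real.sqrt (intΩ Γ (fun x1 x2 => f x1 x2 ^ 2 + q1 f x1 x2 ^ 2 + q2 f x1 x2 ^ 2))

/-- A classical solution of the Boussinesq system on Ω = [0,Γ]×[0,1] with
Rayleigh number Ra, Prandtl number Pr, slip length Ls ∈ (0,∞]
(Navier-slip with friction coefficient `(Ls⁻¹).toReal`; for Ls = ∞ this is free-slip). -/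
structure Sol (Γ Ra Pr : ℝ) (Ls : ℝ≥0∞) where
  u1 : TField
  u2 : TField
  T : TField
  p : TField
  smooth_u1 : tsmooth u1
  smooth_u2 : tsmooth u2
  smooth_T : tsmooth T
  smooth_p : tsmooth p
  periodic_u1 : tperiodic Γ u1
  periodic_u2 : tperiodic Γ u2
  periodic_T : tperiodic Γ T
  periodic_p : tperiodic Γ p
  momentum1 : ∀ t x1 x2, 0 ≤ t → x2 ∈ Icc (0:ℝ) 1 →
    Pr⁻¹ * (dt u1 t x1 x2 + u1 t x1 x2 * d1 u1 t x1 x2 + u2 t x1 x2 * d2 u1 t x1 x2)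
      - (d1 (d1 u1) t x1 x2 + d2 (d2 u1) t x1 x2) + d1 p t x1 x2 = 0
  momentum2 : ∀ t x1 x2, 0 ≤ t → x2 ∈ Icc (0:ℝ) 1 →
    Pr⁻¹ * (dt u2 t x1 x2 + u1 t x1 x2 * d1 u2 t x1 x2 + u2 t x1 x2 * d2 u2 t x1 x2)
      - (d1 (d1 u2) t x1 x2 + d2 (d2 u2) t x1 x2) + d2 p t x1 x2 = Ra * T t x1 x2
  incomp : ∀ t x1 x2, 0 ≤ t → x2 ∈ Icc (0:ℝ) 1 →
    d1 u1 t x1 x2 + d2 u2 t x1 x2 = 0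
  heat : ∀ t x1 x2, 0 ≤ t → x2 ∈ Icc (0:ℝ) 1 →
    dt T t x1 x2 + u1 t x1 x2 * d1 T t x1 x2 + u2 t x1 x2 * d2 T t x1 x2
      - (d1 (d1 T) t x1 x2 + d2 (d2 T) t x1 x2) = 0
  T_bot : ∀ t x1, 0 ≤ t → T t x1 0 = 1
  T_top : ∀ t x1, 0 ≤ t → T t x1 1 = 0
  u2_bot : ∀ t x1, 0 ≤ t → u2 t x1 0 = 0
  u2_top : ∀ t x1, 0 ≤ t → u2 t x1 1 = 0
  slip_top : ∀ t x1, 0 ≤ t → d2 u1 t x1 1 = -(Ls⁻¹).toReal * u1 t x1 1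
  slip_bot : ∀ t x1, 0 ≤ t → d2 u1 t x1 0 = (Ls⁻¹).toReal * u1 t x1 0

variable {Γ Ra Pr : ℝ} {Ls : ℝ≥0∞}

/-- The Nusselt number Nu = ⟨∫₀¹ (u₂T − ∂₂T) dx₂⟩. -/
def Nu (S : Sol Γ Ra Pr Ls) : ℝ :=
  ltavg Γ (fun t x1 => ∫ x2 in (0:ℝ)..1, (S.u2 t x1 x2 * S.T t x1 x2 - d2 S.T t x1 x2))

/-- The initial temperature satisfies 0 ≤ T₀ ≤ 1 on Ω. -/
def T0cond (S : Sol Γ Ra Pr Ls) : Prop :=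
  ∀ x1 x2, x2 ∈ Icc (0:ℝ) 1 → S.T 0 x1 x2 ∈ Icc (0:ℝ) 1

/-- The vorticity ω = ∂₁u₂ − ∂₂u₁. -/
def vort (S : Sol Γ Ra Pr Ls) : TField :=
  fun t x1 x2 => d1 S.u2 t x1 x2 - d2 S.u1 t x1 x2

/-- |∇u|² pointwise. -/
def gradSq (S : Sol Γ Ra Pr Ls) : TField := fun t x1 x2 =>
  d1 S.u1 t x1 x2 ^ 2 + d2 S.u1 t x1 x2 ^ 2 + d1 S.u2 t x1 x2 ^ 2 + d2 S.u2 t x1 x2 ^ 2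

/-- |∇²u|² pointwise: sum of squares of all second spatial derivatives of u. -/
def hessSq (S : Sol Γ Ra Pr Ls) : TField := fun t x1 x2 =>
  d1 (d1 S.u1) t x1 x2 ^ 2 + d1 (d2 S.u1) t x1 x2 ^ 2 +
  d2 (d1 S.u1) t x1 x2 ^ 2 + d2 (d2 S.u1) t x1 x2 ^ 2 +
  d1 (d1 S.u2) t x1 x2 ^ 2 + d1 (d2 S.u2) t x1 x2 ^ 2 +
  d2 (d1 S.u2) t x1 x2 ^ 2 + d2 (d2 S.u2) t x1 x2 ^ 2

/-- ‖u(t)‖_{L²}. -/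
def uL2 (S : Sol Γ Ra Pr Ls) (t : ℝ) : ℝ :=
  Real.sqrt (intΩ Γ (fun x1 x2 => S.u1 t x1 x2 ^ 2 + S.u2 t x1 x2 ^ 2))

/-- ‖u₀‖_{W^{1,4}}. -/
def W14u0 (S : Sol Γ Ra Pr Ls) : ℝ :=
  (intΩ Γ (fun x1 x2 =>
    (S.u1 0 x1 x2 ^ 2 + S.u2 0 x1 x2 ^ 2) ^ 2 + (gradSq S 0 x1 x2) ^ 2)) ^ ((1:ℝ)/4)

/-- ‖ω(t)‖_{L⁴}. -/
def omegaL4 (S : Sol Γ Ra Pr Ls) (t : ℝ) : ℝ :=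
  (intΩ Γ (fun x1 x2 => vort S t x1 x2 ^ 4)) ^ ((1:ℝ)/4)



/-! ### Calculus of smooth fields -/

lemma tsmooth.hasD {f : TField} (hf : tsmooth f) (q : ℝ × ℝ × ℝ) :
    HasFDerivAt (fun q : ℝ × ℝ × ℝ => f q.1 q.2.1 q.2.2)
      (fderiv ℝ (fun q : ℝ × ℝ × ℝ => f q.1 q.2.1 q.2.2) q) q :=
  ((ContDiff.differentiable hf (by simp)) q).hasFDerivAt

lemma tsmooth.dt_eq {f : TField} (hf : tsmooth f) (t x y : ℝ) :
    HasDerivAt (fun s => f s x y)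
      (fderiv ℝ (fun q : ℝ × ℝ × ℝ => f q.1 q.2.1 q.2.2) (t, x, y) (1, 0, 0)) t := by
  have h : HasDerivAt (fun s : ℝ => (s, x, y)) ((1 : ℝ), (0 : ℝ), (0 : ℝ)) t :=
    (hasDerivAt_id t).prodMk ((hasDerivAt_const t x).prodMk (hasDerivAt_const t y))
  exact (hf.hasD (t, x, y)).comp_hasDerivAt t h

lemma tsmooth.d1_eq {f : TField} (hf : tsmooth f) (t x y : ℝ) :
    HasDerivAt (fun s => f t s y)
      (fderiv ℝ (fun q : ℝ × ℝ × ℝ => f q.1 q.2.1 q.2.2) (t, x, y) (0, 1, 0)) x := by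
  have h : HasDerivAt (fun s : ℝ => (t, s, y)) ((0 : ℝ), (1 : ℝ), (0 : ℝ)) x :=
    (hasDerivAt_const x t).prodMk ((hasDerivAt_id x).prodMk (hasDerivAt_const x y))
  exact (hf.hasD (t, x, y)).comp_hasDerivAt x h

lemma tsmooth.d2_eq {f : TField} (hf : tsmooth f) (t x y : ℝ) :
    HasDerivAt (fun s => f t x s)
      (fderiv ℝ (fun q : ℝ × ℝ × ℝ => f q.1 q.2.1 q.2.2) (t, x, y) (0, 0, 1)) y := by
  have h : HasDerivAt (fun s : ℝ => (t, x, s)) ((0 : ℝ), (0 : ℝ), (1 : ℝ)) y :=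
    (hasDerivAt_const y t).prodMk ((hasDerivAt_const y x).prodMk (hasDerivAt_id y))
  exact (hf.hasD (t, x, y)).comp_hasDerivAt y h

lemma tsmooth.hdt {f : TField} (hf : tsmooth f) (t x y : ℝ) :
    HasDerivAt (fun s => f s x y) (dt f t x y) t := by
  have h := hf.dt_eq t x y
  unfold dt; rw [h.deriv]; exact h

lemma tsmooth.hd1 {f : TField} (hf : tsmooth f) (t x y : ℝ) :
    HasDerivAt (fun s => f t s y) (d1 f t x y) x := by
  have h := hf.d1_eq t x y
  unfold d1; rw [h.deriv]; exact h

lemma tsmooth.hd2 {f : TField} (hf : tsmooth f) (t x y : ℝ) :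
    HasDerivAt (fun s => f t x s) (d2 f t x y) y := by
  have h := hf.d2_eq t x y
  unfold d2; rw [h.deriv]; exact h

lemma tsmooth.fd {f : TField} (hf : tsmooth f) (v : ℝ × ℝ × ℝ) :
    ContDiff ℝ (⊤ : ℕ∞) (fun q => fderiv ℝ (fun q : ℝ × ℝ × ℝ => f q.1 q.2.1 q.2.2) q v) := by
  have h : ContDiff ℝ (⊤ : ℕ∞) (fun q => fderiv ℝ (fun q : ℝ × ℝ × ℝ => f q.1 q.2.1 q.2.2) q) :=
    ContDiff.fderiv_right hf (by simp)
  exact h.clm_apply contDiff_const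

lemma tsmooth.dt {f : TField} (hf : tsmooth f) : tsmooth (dt f) := by
  have h : (fun q : ℝ × ℝ × ℝ => RB.dt f q.1 q.2.1 q.2.2) =
    (fun q => fderiv ℝ (fun q : ℝ × ℝ × ℝ => f q.1 q.2.1 q.2.2) q (1, 0, 0)) := by
    funext q; exact (hf.dt_eq q.1 q.2.1 q.2.2).deriv
  unfold tsmooth; rw [h]; exact hf.fd _

lemma tsmooth.d1 {f : TField} (hf : tsmooth f) : tsmooth (d1 f) := by
  have h : (fun q : ℝ × ℝ × ℝ => RB.d1 f q.1 q.2.1 q.2.2) =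
    (fun q => fderiv ℝ (fun q : ℝ × ℝ × ℝ => f q.1 q.2.1 q.2.2) q (0, 1, 0)) := by
    funext q; exact (hf.d1_eq q.1 q.2.1 q.2.2).deriv
  unfold tsmooth; rw [h]; exact hf.fd _

lemma tsmooth.d2 {f : TField} (hf : tsmooth f) : tsmooth (d2 f) := by
  have h : (fun q : ℝ × ℝ × ℝ => RB.d2 f q.1 q.2.1 q.2.2) =
    (fun q => fderiv ℝ (fun q : ℝ × ℝ × ℝ => f q.1 q.2.1 q.2.2) q (0, 0, 1)) := by
    funext q; exact (hf.d2_eq q.1 q.2.1 q.2.2).deriv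
  unfold tsmooth; rw [h]; exact hf.fd _

/-- symmetric second derivatives -/
lemma tsmooth.symm {f : TField} (hf : tsmooth f) (q v w : ℝ × ℝ × ℝ) :
    fderiv ℝ (fun q => fderiv ℝ (fun q : ℝ × ℝ × ℝ => f q.1 q.2.1 q.2.2) q v) q w =
    fderiv ℝ (fun q => fderiv ℝ (fun q : ℝ × ℝ × ℝ => f q.1 q.2.1 q.2.2) q w) q v := by
  have hs : IsSymmSndFDerivAt ℝ (fun q : ℝ × ℝ × ℝ => f q.1 q.2.1 q.2.2) q :=
    (ContDiff.contDiffAt hf).isSymmSndFDerivAt (by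
      simp only [minSmoothness_of_isRCLikeNormedField]
      exact WithTop.coe_le_coe.2 (le_top : (2 : ℕ∞) ≤ ⊤))
  have h : ContDiff ℝ (⊤ : ℕ∞) (fun q => fderiv ℝ (fun q : ℝ × ℝ × ℝ => f q.1 q.2.1 q.2.2) q) :=
    ContDiff.fderiv_right hf (by simp)
  have hd := h.differentiable (by simp) q
  have e : ∀ v w : ℝ × ℝ × ℝ,
      fderiv ℝ (fun q => fderiv ℝ (fun q : ℝ × ℝ × ℝ => f q.1 q.2.1 q.2.2) q v) q w =
      fderiv ℝ (fun q => fderiv ℝ (fun q : ℝ × ℝ × ℝ => f q.1 q.2.1 q.2.2) q) q w v := by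
    intro v w
    have := (hd.hasFDerivAt.clm_apply (hasFDerivAt_const v q)).fderiv
    rw [this]; simp
  rw [e, e]; exact hs w v

lemma dt_unc {f : TField} (hf : tsmooth f) :
    (fun q : ℝ × ℝ × ℝ => RB.dt f q.1 q.2.1 q.2.2) =
    (fun q => fderiv ℝ (fun q : ℝ × ℝ × ℝ => f q.1 q.2.1 q.2.2) q (1, 0, 0)) := by
  funext q; exact (hf.dt_eq q.1 q.2.1 q.2.2).deriv
lemma d1_unc {f : TField} (hf : tsmooth f) :
    (fun q : ℝ × ℝ × ℝ => RB.d1 f q.1 q.2.1 q.2.2) =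
    (fun q => fderiv ℝ (fun q : ℝ × ℝ × ℝ => f q.1 q.2.1 q.2.2) q (0, 1, 0)) := by
  funext q; exact (hf.d1_eq q.1 q.2.1 q.2.2).deriv
lemma d2_unc {f : TField} (hf : tsmooth f) :
    (fun q : ℝ × ℝ × ℝ => RB.d2 f q.1 q.2.1 q.2.2) =
    (fun q => fderiv ℝ (fun q : ℝ × ℝ × ℝ => f q.1 q.2.1 q.2.2) q (0, 0, 1)) := by
  funext q; exact (hf.d2_eq q.1 q.2.1 q.2.2).deriv

lemma d1_d2 {f : TField} (hf : tsmooth f) : d1 (d2 f) = d2 (d1 f) := by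
  funext t x y
  have e1 := (hf.d2.d1_eq t x y).deriv
  have e2 := (hf.d1.d2_eq t x y).deriv
  rw [d2_unc hf] at e1
  rw [d1_unc hf] at e2
  exact e1.trans ((hf.symm _ _ _).trans e2.symm)

lemma dt_d1 {f : TField} (hf : tsmooth f) : RB.dt (RB.d1 f) = RB.d1 (RB.dt f) := by
  funext t x y
  have e1 := (hf.d1.dt_eq t x y).deriv
  have e2 := (hf.dt.d1_eq t x y).deriv
  rw [d1_unc hf] at e1
  rw [dt_unc hf] at e2
  exact e1.trans ((hf.symm _ _ _).trans e2.symm)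

lemma dt_d2 {f : TField} (hf : tsmooth f) : RB.dt (RB.d2 f) = RB.d2 (RB.dt f) := by
  funext t x y
  have e1 := (hf.d2.dt_eq t x y).deriv
  have e2 := (hf.dt.d2_eq t x y).deriv
  rw [d2_unc hf] at e1
  rw [dt_unc hf] at e2
  exact e1.trans ((hf.symm _ _ _).trans e2.symm)

lemma tsmooth.cont {f : TField} (hf : tsmooth f) :
    Continuous (fun q : ℝ × ℝ × ℝ => f q.1 q.2.1 q.2.2) := ContDiff.continuous hf

lemma tsmooth.c2 {f : TField} (hf : tsmooth f) (t : ℝ) :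
    Continuous (fun q : ℝ × ℝ => f t q.1 q.2) :=
  hf.cont.comp (by fun_prop : Continuous (fun q : ℝ × ℝ => (t, q.1, q.2)))

lemma tsmooth.sub {f g : TField} (hf : tsmooth f) (hg : tsmooth g) :
    tsmooth (fun t x y => f t x y - g t x y) := ContDiff.sub hf hg

lemma tsmooth.neg {f : TField} (hf : tsmooth f) :
    tsmooth (fun t x y => - f t x y) := ContDiff.neg hf

lemma tsmooth.cmul {f : TField} (c : ℝ) (hf : tsmooth f) :
    tsmooth (fun t x y => c * f t x y) := ContDiff.mul contDiff_const hf

lemma per_d1 {Γ : ℝ} {f : TField} (hp : tperiodic Γ f) : tperiodic Γ (d1 f) := by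
  intro t x y
  unfold d1
  have := deriv_comp_add_const (fun s => f t s y) Γ x
  simp only [hp t _ y] at this
  exact this.symm

lemma per_d2 {Γ : ℝ} {f : TField} (hp : tperiodic Γ f) : tperiodic Γ (d2 f) := by
  intro t x y
  unfold d2
  simp only [hp t x _]

lemma per_dt {Γ : ℝ} {f : TField} (hp : tperiodic Γ f) : tperiodic Γ (dt f) := by
  intro t x y
  unfold dt
  simp only [hp _ x y]

/-! ### Integration over Ω -/

lemma cont_intOn {g : SField} (hg : Continuous (fun q : ℝ × ℝ => g q.1 q.2)) (a b c d : ℝ) :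
    IntegrableOn (fun q : ℝ × ℝ => g q.1 q.2) (Ioc a b ×ˢ Ioc c d) := by
  have : IntegrableOn (fun q : ℝ × ℝ => g q.1 q.2) (Icc a b ×ˢ Icc c d) :=
    hg.continuousOn.integrableOn_compact (isCompact_Icc.prod isCompact_Icc)
  exact this.mono_set (Set.prod_mono Ioc_subset_Icc_self Ioc_subset_Icc_self)

lemma intΩ_eq (Γ : ℝ) {g : SField} (hg : Continuous (fun q : ℝ × ℝ => g q.1 q.2)) :
    intΩ Γ g = ∫ q in Ioc (0:ℝ) Γ ×ˢ Ioc (0:ℝ) 1, g q.1 q.2 := by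
  unfold intΩ
  rw [Measure.volume_eq_prod, setIntegral_prod _ (by
    rw [← Measure.volume_eq_prod]; exact cont_intOn hg _ _ _ _)]

lemma intΩ_swap (Γ : ℝ) {g : SField} (hg : Continuous (fun q : ℝ × ℝ => g q.1 q.2)) :
    intΩ Γ g = ∫ y in Ioc (0:ℝ) 1, ∫ x in Ioc (0:ℝ) Γ, g x y := by
  unfold intΩ
  refine integral_integral_swap (f := g) ?_
  have := cont_intOn hg 0 Γ 0 1
  rw [IntegrableOn, Measure.volume_eq_prod, ← Measure.prod_restrict] at this
  exact this

lemma intΩ_add (Γ : ℝ) {f g : SField} (hf : Continuous (fun q : ℝ × ℝ => f q.1 q.2))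
    (hg : Continuous (fun q : ℝ × ℝ => g q.1 q.2)) :
    intΩ Γ (fun x y => f x y + g x y) = intΩ Γ f + intΩ Γ g := by
  rw [intΩ_eq Γ hf, intΩ_eq Γ hg, intΩ_eq Γ (hf.add hg)]
  exact integral_add (cont_intOn hf _ _ _ _) (cont_intOn hg _ _ _ _)

lemma intΩ_cmul (Γ c : ℝ) {f : SField} :
    intΩ Γ (fun x y => c * f x y) = c * intΩ Γ f := by
  unfold intΩ
  simp only [integral_const_mul]

lemma intΩ_const (Γ c : ℝ) (hΓ : 0 < Γ) :
    intΩ Γ (fun _ _ => c) = Γ * c := by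
  unfold intΩ
  simp [hΓ.le]

lemma intΩ_mono {Γ : ℝ} {f g : SField} (hf : Continuous (fun q : ℝ × ℝ => f q.1 q.2))
    (hg : Continuous (fun q : ℝ × ℝ => g q.1 q.2))
    (h : ∀ x y, y ∈ Icc (0:ℝ) 1 → f x y ≤ g x y) : intΩ Γ f ≤ intΩ Γ g := by
  rw [intΩ_eq Γ hf, intΩ_eq Γ hg]
  exact setIntegral_mono_on (cont_intOn hf _ _ _ _) (cont_intOn hg _ _ _ _)
    (measurableSet_Ioc.prod measurableSet_Ioc)
    (fun q hq => h q.1 q.2 (Ioc_subset_Icc_self hq.2))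

lemma intΩ_nonneg {Γ : ℝ} {f : SField} (h : ∀ x y, 0 ≤ f x y) : 0 ≤ intΩ Γ f := by
  unfold intΩ
  exact integral_nonneg (fun x => integral_nonneg (fun y => h x y))

lemma intΩ_d1 {Γ : ℝ} (hΓ : 0 < Γ) {G G' : SField}
    (hd : ∀ x y, HasDerivAt (fun s => G s y) (G' x y) x)
    (hc : Continuous (fun q : ℝ × ℝ => G' q.1 q.2))
    (hp : ∀ x y, G (x + Γ) y = G x y) : intΩ Γ G' = 0 := by
  rw [intΩ_swap Γ hc]
  have : ∀ y, ∫ x in Ioc (0:ℝ) Γ, G' x y = 0 := by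
    intro y
    rw [← intervalIntegral.integral_of_le hΓ.le,
      intervalIntegral.integral_eq_sub_of_hasDerivAt (f := fun s => G s y) (fun x _ => hd x y)]
    · have := hp 0 y; simp only [zero_add] at this; rw [this]; ring
    · exact (hc.comp (by fun_prop : Continuous (fun x : ℝ => (x, y)))).intervalIntegrable _ _
  simp [this]

lemma intΩ_d2 {Γ : ℝ} {G G' : SField}
    (hd : ∀ x y, HasDerivAt (fun s => G x s) (G' x y) y)
    (hc : Continuous (fun q : ℝ × ℝ => G' q.1 q.2)) :
    intΩ Γ G' = ∫ x in Ioc (0:ℝ) Γ, (G x 1 - G x 0) := by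
  unfold intΩ
  congr 1
  funext x
  rw [← intervalIntegral.integral_of_le zero_le_one,
      intervalIntegral.integral_eq_sub_of_hasDerivAt (f := fun s => G x s) (fun y _ => hd x y)]
  exact (hc.comp (by fun_prop : Continuous (fun y : ℝ => (x, y)))).intervalIntegrable _ _

/-- differentiation under the integral sign over a set contained in a compact set -/
lemma hasDerivAt_param {X : Type*} [TopologicalSpace X] [MeasurableSpace X]
    [OpensMeasurableSpace X] [SecondCountableTopology X] [T2Space X]
    {μ : Measure X} [IsFiniteMeasureOnCompacts μ] {K s : Set X} (hK : IsCompact K) (hs : s ⊆ K)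
    (hsm : MeasurableSet s)
    {G G' : ℝ → X → ℝ} (hd : ∀ t x, HasDerivAt (fun t => G t x) (G' t x) t)
    (hc : ∀ t, Continuous (G t)) (hcder : Continuous (fun q : ℝ × X => G' q.1 q.2)) (t : ℝ) :
    HasDerivAt (fun t => ∫ x in s, G t x ∂μ) (∫ x in s, G' t x ∂μ) t := by
  obtain ⟨C, hC⟩ := ((isCompact_Icc (a := t - 1) (b := t + 1)).prod hK).exists_bound_of_continuousOn
    hcder.continuousOn
  have hfin : μ s < ⊤ := lt_of_le_of_lt (measure_mono hs) hK.measure_lt_top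
  have hint : ∀ f : X → ℝ, Continuous f → IntegrableOn f s μ := fun f hf =>
    (hf.continuousOn.integrableOn_compact' hK hK.measurableSet).mono_set hs
  refine (hasDerivAt_integral_of_dominated_loc_of_deriv_le (μ := μ.restrict s)
    (s := Icc (t - 1) (t + 1)) (bound := fun _ => C)
    (Icc_mem_nhds (by linarith) (by linarith)) ?_ (hint _ (hc t)) ?_ ?_ ?_ ?_).2
  · exact Eventually.of_forall (fun t => (hint _ (hc t)).aestronglyMeasurable)
  · exact (hint _ (hcder.comp (by fun_prop : Continuous (fun x : X => (t, x))))).aestronglyMeasurable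
  · refine (ae_restrict_iff' hsm).2 (Eventually.of_forall ?_)
    intro x hx t' ht'
    exact hC (t', x) ⟨ht', hs hx⟩
  · exact integrableOn_const (hs := hfin.ne)
  · exact Eventually.of_forall (fun x t' _ => hd t' x)

lemma intΩ_dt {Γ : ℝ} {G G' : TField}
    (hd : ∀ t x y, HasDerivAt (fun s => G s x y) (G' t x y) t)
    (hc : Continuous (fun q : ℝ × ℝ × ℝ => G q.1 q.2.1 q.2.2))
    (hcder : Continuous (fun q : ℝ × ℝ × ℝ => G' q.1 q.2.1 q.2.2)) (t : ℝ) :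
    HasDerivAt (fun s => intΩ Γ (G s)) (intΩ Γ (G' t)) t := by
  have h1 : ∀ t, Continuous (fun q : ℝ × ℝ => G t q.1 q.2) := fun t =>
    hc.comp (by fun_prop : Continuous (fun q : ℝ × ℝ => (t, q.1, q.2)))
  have h2 : ∀ t, Continuous (fun q : ℝ × ℝ => G' t q.1 q.2) := fun t =>
    hcder.comp (by fun_prop : Continuous (fun q : ℝ × ℝ => (t, q.1, q.2)))
  have e : (fun s => intΩ Γ (G s)) =
      fun s => ∫ q in Ioc (0:ℝ) Γ ×ˢ Ioc (0:ℝ) 1, G s q.1 q.2 := by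
    funext s; exact intΩ_eq Γ (h1 s)
  rw [e, intΩ_eq Γ (h2 t)]
  exact hasDerivAt_param (K := Icc (0:ℝ) Γ ×ˢ Icc (0:ℝ) 1) (isCompact_Icc.prod isCompact_Icc)
    (Set.prod_mono Ioc_subset_Icc_self Ioc_subset_Icc_self)
    (measurableSet_Ioc.prod measurableSet_Ioc)
    (G := fun t q => G t q.1 q.2) (G' := fun t q => G' t q.1 q.2) (fun t q => hd t q.1 q.2)
    h1 hcder t

/-- Gronwall-type lemma -/
lemma ode_bound {y y' : ℝ → ℝ} {c N t0 : ℝ} (hN : 0 ≤ N) (hy0 : 0 ≤ y 0)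
    (hc : 0 < c)
    (hd : ∀ t, HasDerivAt y (y' t) t) (h : ∀ t ∈ Icc 0 t0, y' t ≤ - c * (y t - N)) :
    ∀ t ∈ Icc 0 t0, y t ≤ y 0 + N := by
  have hg : ∀ t, HasDerivAt (fun t => Real.exp (c * t) * (y t - N))
      (Real.exp (c * t) * (c * 1) * (y t - N) + Real.exp (c * t) * (y' t)) t := by
    intro t
    exact (((hasDerivAt_id t).const_mul c).exp).mul ((hd t).sub_const N)
  have anti : AntitoneOn (fun t => Real.exp (c * t) * (y t - N)) (Icc 0 t0) := by
    refine antitoneOn_of_deriv_nonpos (convex_Icc _ _)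
      (fun t _ => (hg t).continuousAt.continuousWithinAt)
      (fun t _ => (hg t).differentiableAt.differentiableWithinAt) ?_
    intro t ht
    rw [(hg t).deriv]
    have := h t (interior_subset ht)
    have he := Real.exp_pos (c * t)
    nlinarith
  intro t ht
  have h1 := anti ⟨le_rfl, ht.1.trans ht.2⟩ ht ht.1
  simp only [mul_zero, Real.exp_zero, one_mul] at h1
  have he : 1 ≤ Real.exp (c * t) := Real.one_le_exp (mul_nonneg hc.le ht.1)
  by_contra hcon
  push Not at hcon
  have : 0 < y t - N := by linarith
  nlinarith


/-! ### Truncated energy estimate -/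

lemma hasDerivAt_pospow (n : ℕ) (z : ℝ) :
    HasDerivAt (fun z : ℝ => (max z 0) ^ (n + 2)) ((n + 2 : ℝ) * (max z 0) ^ (n + 1)) z := by
  have hp : HasDerivAt (fun z : ℝ => z ^ (n + 2)) ((n + 2 : ℝ) * z ^ (n + 1)) z := by
    have := hasDerivAt_pow (n + 2) z
    have e : ((n:ℝ) + 2) = ((n + 2 : ℕ) : ℝ) := by push_cast; ring
    rw [e]; exact this
  rcases lt_trichotomy z 0 with h | h | h
  · have : (fun z : ℝ => (max z 0) ^ (n + 2)) =ᶠ[nhds z] fun _ => 0 := by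
      filter_upwards [Iio_mem_nhds h] with w hw
      rw [max_eq_right (le_of_lt hw)]; simp
    rw [max_eq_right h.le]
    have h2 := (hasDerivAt_const z (0:ℝ)).congr_of_eventuallyEq this
    simpa using h2
  · subst h
    have h1 : HasDerivWithinAt (fun z : ℝ => (max z 0) ^ (n + 2)) 0 (Iic 0) 0 := by
      refine (hasDerivWithinAt_const (0:ℝ) (Iic 0) (0:ℝ)).congr ?_ ?_
      · intro w hw; rw [max_eq_right hw]; simp
      · simp
    have h2 : HasDerivWithinAt (fun z : ℝ => (max z 0) ^ (n + 2)) 0 (Ici 0) 0 := by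
      have h3 := hp.hasDerivWithinAt (s := Ici 0)
      simp only [ne_eq, Nat.add_eq_zero_iff, one_ne_zero, and_false, not_false_eq_true, zero_pow,
        mul_zero] at h3
      refine h3.congr ?_ ?_
      · intro w hw; rw [max_eq_left hw]
      · simp
    have h3 := h1.union h2
    rw [Iic_union_Ici, hasDerivWithinAt_univ] at h3
    simpa using h3
  · have : (fun z : ℝ => (max z 0) ^ (n + 2)) =ᶠ[nhds z] fun z => z ^ (n + 2) := by
      filter_upwards [Ioi_mem_nhds h] with w hw
      rw [max_eq_left (le_of_lt hw)]
    rw [max_eq_left h.le]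
    exact hp.congr_of_eventuallyEq this

lemma hasDerivAt_pos4 {f : ℝ → ℝ} {f' z : ℝ} (Λ : ℝ) (hf : HasDerivAt f f' z) :
    HasDerivAt (fun z : ℝ => (max (f z - Λ) 0) ^ 4) (4 * (max (f z - Λ) 0) ^ 3 * f') z := by
  have h := (hasDerivAt_pospow 2 (f z - Λ)).comp z (hf.sub_const Λ)
  have e : (((2:ℕ) : ℝ) + 2) = 4 := by norm_num
  rw [e] at h
  exact h

lemma hasDerivAt_pos3 {f : ℝ → ℝ} {f' z : ℝ} (Λ : ℝ) (hf : HasDerivAt f f' z) :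
    HasDerivAt (fun z : ℝ => (max (f z - Λ) 0) ^ 3) (3 * (max (f z - Λ) 0) ^ 2 * f') z := by
  have h := (hasDerivAt_pospow 1 (f z - Λ)).comp z (hf.sub_const Λ)
  have e : (((1:ℕ) : ℝ) + 2) = 3 := by norm_num
  rw [e] at h
  exact h

lemma trunc_pointwise {m θ1 θ2 F K y : ℝ} (hy0 : 0 ≤ y) (hy1 : y ≤ 1)
    (hF : |F| ≤ K) :
    - 12 * m ^ 2 * (θ1 ^ 2 + θ2 ^ 2) - 12 * m ^ 2 * θ1 * F - m ^ 4 - 4 * y * m ^ 3 * θ2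
      ≤ - (1 / 4) * m ^ 4 + 9 * K ^ 4 := by
  have hF2 : F ^ 2 ≤ K ^ 2 := by
    rw [← sq_abs F]; exact pow_le_pow_left₀ (abs_nonneg _) hF 2
  have h1 : -12 * m ^ 2 * θ1 ^ 2 - 12 * m ^ 2 * θ1 * F ≤ 3 * m ^ 2 * F ^ 2 := by
    nlinarith [sq_nonneg (m * (2 * θ1 + F))]
  have h2 : 3 * m ^ 2 * F ^ 2 ≤ 3 * m ^ 2 * K ^ 2 := by
    apply mul_le_mul_of_nonneg_left hF2; positivity
  have h3 : 3 * m ^ 2 * K ^ 2 ≤ (1/4) * m ^ 4 + 9 * K ^ 4 := by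
    nlinarith [sq_nonneg (m ^ 2 / 2 - 3 * K ^ 2)]
  have h4 : -12 * m ^ 2 * θ2 ^ 2 - 4 * y * m ^ 3 * θ2 ≤ (1/3) * (y^2 * m ^ 4) := by
    nlinarith [sq_nonneg (m * (6 * θ2 + y * m))]
  have h5 : y ^ 2 * m ^ 4 ≤ 1 * m ^ 4 := by
    apply mul_le_mul_of_nonneg_right _ (by positivity)
    nlinarith
  have h6 : 0 ≤ m ^ 4 := by positivity
  nlinarith

lemma trunc_energy {Γ a K Λ t0 : ℝ} (hΓ : 0 < Γ) (ha : 0 < a) {u1 u2 θ F : TField}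
    (su1 : tsmooth u1) (su2 : tsmooth u2) (sθ : tsmooth θ) (sF : tsmooth F)
    (pu1 : tperiodic Γ u1) (pθ : tperiodic Γ θ)
    (pF : tperiodic Γ F)
    (hdiv : ∀ t x y, 0 ≤ t → y ∈ Icc (0:ℝ) 1 → d1 u1 t x y + d2 u2 t x y = 0)
    (heq : ∀ t x y, 0 ≤ t → y ∈ Icc (0:ℝ) 1 →
      a * (dt θ t x y + u1 t x y * d1 θ t x y + u2 t x y * d2 θ t x y)
        - (d1 (d1 θ) t x y + d2 (d2 θ) t x y) = d1 F t x y)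
    (hF : ∀ t x y, 0 ≤ t → y ∈ Icc (0:ℝ) 1 → |F t x y| ≤ K)
    (hb0 : ∀ t ∈ Icc 0 t0, ∀ x, θ t x 0 ≤ Λ) (hb1 : ∀ t ∈ Icc 0 t0, ∀ x, θ t x 1 ≤ Λ) :
    ∀ t ∈ Icc 0 t0, intΩ Γ (fun x y => (max (θ t x y - Λ) 0) ^ 4) ≤
      intΩ Γ (fun x y => (max (θ 0 x y - Λ) 0) ^ 4) + 36 * Γ * K ^ 4 := by
  have cθ := sθ.cont
  have cθt := sθ.dt.cont
  have hder : ∀ t, HasDerivAt (fun t => intΩ Γ (fun x y => (max (θ t x y - Λ) 0) ^ 4))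
      (intΩ Γ (fun x y => 4 * (max (θ t x y - Λ) 0) ^ 3 * dt θ t x y)) t := by
    intro t
    refine intΩ_dt (G := fun t x y => (max (θ t x y - Λ) 0) ^ 4)
      (G' := fun t x y => 4 * (max (θ t x y - Λ) 0) ^ 3 * dt θ t x y) ?_ ?_ ?_ t
    · intro t x y; exact hasDerivAt_pos4 Λ (sθ.hdt t x y)
    · exact ((cθ.sub continuous_const).max continuous_const).pow 4
    · exact (continuous_const.mul (((cθ.sub continuous_const).max continuous_const).pow 3)).mul cθt
  refine ode_bound (c := 1 / (4 * a)) (by positivity)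
    (intΩ_nonneg (fun x y => by positivity)) (by positivity) hder ?_
  intro t ht
  set m : SField := fun x y => max (θ t x y - Λ) 0 with hm
  have cm : Continuous (fun q : ℝ × ℝ => m q.1 q.2) :=
    ((sθ.c2 t).sub continuous_const).max continuous_const
  have cu1 := su1.c2 t
  have cu2 := su2.c2 t
  have cF := sF.c2 t
  have c1 := sθ.d1.c2 t
  have c2 := sθ.d2.c2 t
  have c11 := sθ.d1.d1.c2 t
  have c22 := sθ.d2.d2.c2 t
  have cF1 := sF.d1.c2 t
  have cu11 := su1.d1.c2 t
  have cu22 := su2.d2.c2 t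
  have ct := sθ.dt.c2 t
  set A' : SField := fun x y => -a * (d1 u1 t x y * m x y ^ 4 + u1 t x y * (4 * m x y ^ 3 * d1 θ t x y))
    + 4 * (3 * m x y ^ 2 * d1 θ t x y * d1 θ t x y + m x y ^ 3 * d1 (d1 θ) t x y)
    + 4 * (3 * m x y ^ 2 * d1 θ t x y * F t x y + m x y ^ 3 * d1 F t x y) with hA'
  set B' : SField := fun x y => -a * (d2 u2 t x y * m x y ^ 4 + u2 t x y * (4 * m x y ^ 3 * d2 θ t x y))
    + 4 * (3 * m x y ^ 2 * d2 θ t x y * d2 θ t x y + m x y ^ 3 * d2 (d2 θ) t x y)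
    + (1 * m x y ^ 4 + y * (4 * m x y ^ 3 * d2 θ t x y)) with hB'
  have cA : Continuous (fun q : ℝ × ℝ => A' q.1 q.2) := by
    simp only [hA']; fun_prop
  have cB : Continuous (fun q : ℝ × ℝ => B' q.1 q.2) := by
    simp only [hB']; fun_prop
  have iA : intΩ Γ A' = 0 := by
    refine intΩ_d1 hΓ (G := fun x y => -a * (u1 t x y * m x y ^ 4) + 4 * (m x y ^ 3 * d1 θ t x y)
      + 4 * (m x y ^ 3 * F t x y)) ?_ cA ?_
    · intro x y
      have h4 := hasDerivAt_pos4 Λ (sθ.hd1 t x y)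
      have h3 := hasDerivAt_pos3 Λ (sθ.hd1 t x y)
      exact ((((su1.hd1 t x y).mul h4).const_mul (-a)).add
        ((h3.mul (sθ.d1.hd1 t x y)).const_mul 4)).add ((h3.mul (sF.hd1 t x y)).const_mul 4)
    · intro x y
      simp only [hm, pθ t x y, pu1 t x y, pF t x y, per_d1 pθ t x y]
  have iB : intΩ Γ B' = 0 := by
    rw [intΩ_d2 (G := fun x y => -a * (u2 t x y * m x y ^ 4) + 4 * (m x y ^ 3 * d2 θ t x y)
      + y * m x y ^ 4) ?_ cB]
    · have m0 : ∀ x, m x 0 = 0 := fun x => by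
        simp only [hm]; exact max_eq_right (by linarith [hb0 t ht x])
      have m1 : ∀ x, m x 1 = 0 := fun x => by
        simp only [hm]; exact max_eq_right (by linarith [hb1 t ht x])
      simp [m0, m1]
    · intro x y
      have h4 := hasDerivAt_pos4 Λ (sθ.hd2 t x y)
      have h3 := hasDerivAt_pos3 Λ (sθ.hd2 t x y)
      exact ((((su2.hd2 t x y).mul h4).const_mul (-a)).add
        ((h3.mul (sθ.d2.hd2 t x y)).const_mul 4)).add ((hasDerivAt_id y).mul h4)
  have key : intΩ Γ (fun x y => a * (4 * m x y ^ 3 * dt θ t x y)) ≤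
      intΩ Γ (fun x y => (A' x y + B' x y) + (-(1/4) * m x y ^ 4 + 9 * K ^ 4)) := by
    apply intΩ_mono
    · fun_prop
    · fun_prop
    · intro x y hy
      have h1 := heq t x y ht.1 hy
      have h2 := hdiv t x y ht.1 hy
      have h3 := trunc_pointwise (m := m x y) (θ1 := d1 θ t x y) (θ2 := d2 θ t x y)
        hy.1 hy.2 (hF t x y ht.1 hy)
      have h4 : a * dt θ t x y = d1 (d1 θ) t x y + d2 (d2 θ) t x y + d1 F t x y
         - a * (u1 t x y * d1 θ t x y + u2 t x y * d2 θ t x y) := by linarith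
      have h5 : d2 u2 t x y = - d1 u1 t x y := by linarith
      have h6 : a * (4 * m x y ^ 3 * dt θ t x y) = 4 * m x y ^ 3 * (a * dt θ t x y) := by ring
      rw [h6, h4]
      simp only [hA', hB', h5]
      linarith
  have c4 : Continuous (fun q : ℝ × ℝ => -(1/4) * m q.1 q.2 ^ 4) := by fun_prop
  rw [intΩ_add Γ (by fun_prop) (by fun_prop), intΩ_add Γ cA cB, iA, iB,
    intΩ_add Γ c4 continuous_const, intΩ_cmul, intΩ_cmul, intΩ_const _ _ hΓ] at key
  have h7 : intΩ Γ (fun x y => 4 * m x y ^ 3 * dt θ t x y) ≤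
      a⁻¹ * (-(1/4) * intΩ Γ (fun x y => m x y ^ 4) + Γ * (9 * K ^ 4)) := by
    rw [inv_mul_eq_div, le_div_iff₀ ha]; linarith
  refine h7.trans (le_of_eq ?_)
  field_simp
  ring

lemma intΩ_zero_pt {Γ : ℝ} (hΓ : 0 < Γ) {g : SField}
    (hg : Continuous (fun q : ℝ × ℝ => g q.1 q.2)) (h0 : ∀ x y, 0 ≤ g x y)
    (hi : intΩ Γ g ≤ 0) : ∀ x ∈ Icc (0:ℝ) Γ, ∀ y ∈ Icc (0:ℝ) 1, g x y = 0 := by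
  have hz : ∫ q in Ioc (0:ℝ) Γ ×ˢ Ioc (0:ℝ) 1, g q.1 q.2 = 0 := by
    rw [← intΩ_eq Γ hg]; exact le_antisymm hi (intΩ_nonneg h0)
  have hae := (setIntegral_eq_zero_iff_of_nonneg_ae
    (Eventually.of_forall (fun q : ℝ × ℝ => h0 q.1 q.2)) (cont_intOn hg 0 Γ 0 1)).1 hz
  have hsub : Ioo (0:ℝ) Γ ×ˢ Ioo (0:ℝ) 1 ⊆ Ioc (0:ℝ) Γ ×ˢ Ioc (0:ℝ) 1 :=
    Set.prod_mono Ioo_subset_Ioc_self Ioo_subset_Ioc_self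
  have hae2 : (fun q : ℝ × ℝ => g q.1 q.2) =ᵐ[volume.restrict (Ioo (0:ℝ) Γ ×ˢ Ioo (0:ℝ) 1)] 0 :=
    ae_restrict_of_ae_restrict_of_subset hsub hae
  have heq := Measure.eqOn_open_of_ae_eq hae2 (isOpen_Ioo.prod isOpen_Ioo) hg.continuousOn
    continuousOn_const
  have hcl := heq.closure hg continuous_const
  rw [closure_prod_eq, closure_Ioo hΓ.ne, closure_Ioo zero_ne_one] at hcl
  intro x hx y hy
  exact hcl (show (x, y) ∈ _ from ⟨hx, hy⟩)

lemma per_reduce {Γ : ℝ} (hΓ : 0 < Γ) {g : SField} {p : ℝ → Prop}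
    (hp : ∀ x y, g (x + Γ) y = g x y) (y : ℝ)
    (h : ∀ x ∈ Icc (0:ℝ) Γ, p (g x y)) : ∀ x, p (g x y) := by
  intro x
  have hper : Function.Periodic (fun x => g x y) Γ := fun x => hp x y
  obtain ⟨z, hz, e⟩ := hper.exists_mem_Ico₀ hΓ x
  have := h z ⟨hz.1, hz.2.le⟩
  rw [e]; exact this


lemma max_zero {Γ Λ t0 : ℝ} (hΓ : 0 < Γ) {u1 u2 θ : TField}
    (su1 : tsmooth u1) (su2 : tsmooth u2) (sθ : tsmooth θ)
    (pu1 : tperiodic Γ u1) (pθ : tperiodic Γ θ)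
    (hdiv : ∀ t x y, 0 ≤ t → y ∈ Icc (0:ℝ) 1 → d1 u1 t x y + d2 u2 t x y = 0)
    (heq : ∀ t x y, 0 ≤ t → y ∈ Icc (0:ℝ) 1 →
      dt θ t x y + u1 t x y * d1 θ t x y + u2 t x y * d2 θ t x y
        - (d1 (d1 θ) t x y + d2 (d2 θ) t x y) = 0)
    (hb0 : ∀ t ∈ Icc 0 t0, ∀ x, θ t x 0 ≤ Λ) (hb1 : ∀ t ∈ Icc 0 t0, ∀ x, θ t x 1 ≤ Λ)
    (hi : ∀ x y, y ∈ Icc (0:ℝ) 1 → θ 0 x y ≤ Λ) :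
    ∀ t ∈ Icc 0 t0, ∀ x y, y ∈ Icc (0:ℝ) 1 → θ t x y ≤ Λ := by
  intro t ht x y hy
  have z1 : d1 (fun _ _ _ => (0:ℝ)) = fun _ _ _ => 0 := by funext t x y; simp [d1]
  have h := trunc_energy (a := 1) (K := 0) (F := fun _ _ _ => 0) hΓ one_pos su1 su2 sθ
    contDiff_const pu1 pθ (fun _ _ _ => rfl) hdiv
    (fun t x y h1 h2 => by rw [z1, one_mul]; exact heq t x y h1 h2) (fun t x y _ _ => by simp) hb0 hb1 t ht
  have h0 : intΩ Γ (fun x y => (max (θ 0 x y - Λ) 0) ^ 4) ≤ 0 := by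
    have : intΩ Γ (fun x y => (max (θ 0 x y - Λ) 0) ^ 4) ≤ intΩ Γ (fun _ _ => 0) := by
      apply intΩ_mono
      · exact (((sθ.c2 0).sub continuous_const).max continuous_const).pow 4
      · exact continuous_const
      · intro x y hy
        rw [max_eq_right (by linarith [hi x y hy])]; simp
    rwa [intΩ_const _ _ hΓ, mul_zero] at this
  have h1 := intΩ_zero_pt hΓ (g := fun x y => (max (θ t x y - Λ) 0) ^ 4)
    ((((sθ.c2 t).sub continuous_const).max continuous_const).pow 4)
    (fun x y => by positivity) (by norm_num at h; linarith)
  refine per_reduce hΓ (g := fun x y => θ t x y) (p := fun z => z ≤ Λ) (fun x y => pθ t x y) y ?_ x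
  intro x hx
  have h2 := h1 x hx y hy
  have h3 := pow_eq_zero_iff (n := 4) (by norm_num) |>.1 h2
  have := le_max_left (θ t x y - Λ) 0
  linarith

lemma T_bounds (hΓ : 0 < Γ) (S : Sol Γ Ra Pr Ls) (hT : T0cond S) :
    ∀ t x y, 0 ≤ t → y ∈ Icc (0:ℝ) 1 → |S.T t x y| ≤ 1 := by
  intro t x y ht hy
  rw [abs_le]
  constructor
  · have n1 : ∀ f : TField, d1 (fun t x y => - f t x y) = fun t x y => - d1 f t x y := by
      intro f; funext t x y; simp [d1]
    have n2 : ∀ f : TField, d2 (fun t x y => - f t x y) = fun t x y => - d2 f t x y := by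
      intro f; funext t x y; simp [d2]
    have nt : ∀ f : TField, dt (fun t x y => - f t x y) = fun t x y => - dt f t x y := by
      intro f; funext t x y; simp [dt]
    have h := max_zero (Λ := 0) (t0 := t) hΓ S.smooth_u1 S.smooth_u2 S.smooth_T.neg S.periodic_u1
      (fun t x y => congrArg Neg.neg (S.periodic_T t x y)) S.incomp
      (fun t x y h1 h2 => by
        have := S.heat t x y h1 h2
        simp only [n1, n2, nt]; linarith)
      (fun t ht x => by rw [S.T_bot t x ht.1]; norm_num)
      (fun t ht x => by rw [S.T_top t x ht.1]; norm_num)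
      (fun x y hy => by linarith [(hT x y hy).1]) t ⟨ht, le_rfl⟩ x y hy
    linarith
  · exact max_zero (Λ := 1) (t0 := t) hΓ S.smooth_u1 S.smooth_u2 S.smooth_T S.periodic_u1
      S.periodic_T S.incomp S.heat
      (fun t ht x => by rw [S.T_bot t x ht.1])
      (fun t ht x => by rw [S.T_top t x ht.1]; norm_num)
      (fun x y hy => (hT x y hy).2) t ⟨ht, le_rfl⟩ x y hy

/-! ### Vorticity equation -/


lemma vort_smooth (S : Sol Γ Ra Pr Ls) : tsmooth (vort S) :=
  S.smooth_u2.d1.sub S.smooth_u1.d2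

lemma vort_periodic (S : Sol Γ Ra Pr Ls) : tperiodic Γ (vort S) := by
  intro t x y
  unfold vort
  rw [per_d1 S.periodic_u2 t x y, per_d2 S.periodic_u1 t x y]

lemma d1_sub {f g : TField} (hf : tsmooth f) (hg : tsmooth g) :
    d1 (fun t x y => f t x y - g t x y) = fun t x y => d1 f t x y - d1 g t x y := by
  funext t x y; exact ((hf.hd1 t x y).sub (hg.hd1 t x y)).deriv
lemma d2_sub {f g : TField} (hf : tsmooth f) (hg : tsmooth g) :
    d2 (fun t x y => f t x y - g t x y) = fun t x y => d2 f t x y - d2 g t x y := by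
  funext t x y; exact ((hf.hd2 t x y).sub (hg.hd2 t x y)).deriv
lemma dt_sub {f g : TField} (hf : tsmooth f) (hg : tsmooth g) :
    dt (fun t x y => f t x y - g t x y) = fun t x y => dt f t x y - dt g t x y := by
  funext t x y; exact ((hf.hdt t x y).sub (hg.hdt t x y)).deriv

lemma d1_cmul {f : TField} (c : ℝ) (hf : tsmooth f) :
    d1 (fun t x y => c * f t x y) = fun t x y => c * d1 f t x y := by
  funext t x y; exact ((hf.hd1 t x y).const_mul c).deriv

lemma vort_eq (S : Sol Γ Ra Pr Ls) (t x y : ℝ) (ht : 0 ≤ t) (hy : y ∈ Icc (0:ℝ) 1) :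
    Pr⁻¹ * (dt (vort S) t x y + S.u1 t x y * d1 (vort S) t x y + S.u2 t x y * d2 (vort S) t x y)
      - (d1 (d1 (vort S)) t x y + d2 (d2 (vort S)) t x y)
      = d1 (fun t x y => Ra * S.T t x y) t x y := by
  have s1 := S.smooth_u1
  have s2 := S.smooth_u2
  have sT := S.smooth_T
  have sp := S.smooth_p
  have sw := vort_smooth S
  -- reduce to interior points
  suffices H : ∀ y ∈ Ioo (0:ℝ) 1,
    Pr⁻¹ * (dt (vort S) t x y + S.u1 t x y * d1 (vort S) t x y + S.u2 t x y * d2 (vort S) t x y)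
      - (d1 (d1 (vort S)) t x y + d2 (d2 (vort S)) t x y)
      = d1 (fun t x y => Ra * S.T t x y) t x y by
    have cc : ∀ {f : TField}, tsmooth f → Continuous (fun y => f t x y) := fun hf =>
      hf.cont.comp (by fun_prop : Continuous (fun y : ℝ => (t, x, y)))
    have c1 := cc s1
    have c2 := cc s2
    have c3 := cc sw.dt
    have c4 := cc sw.d1
    have c5 := cc sw.d2
    have c6 := cc sw.d1.d1
    have c7 := cc sw.d2.d2
    have c8 := cc (sT.cmul Ra).d1
    have hE : EqOn (fun y => Pr⁻¹ * (dt (vort S) t x y + S.u1 t x y * d1 (vort S) t x y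
        + S.u2 t x y * d2 (vort S) t x y)
      - (d1 (d1 (vort S)) t x y + d2 (d2 (vort S)) t x y))
      (fun y => d1 (fun t x y => Ra * S.T t x y) t x y) (Ioo 0 1) := H
    have := hE.closure (by fun_prop) c8
    rw [closure_Ioo zero_ne_one] at this
    exact this hy
  intro y hy
  have hyc : y ∈ Icc (0:ℝ) 1 := Ioo_subset_Icc_self hy
  have hnb : Ioo (0:ℝ) 1 ∈ nhds y := Ioo_mem_nhds hy.1 hy.2
  -- x-derivative of the second momentum equation
  have m2 : HasDerivAt (fun x => Pr⁻¹ * (dt S.u2 t x y + S.u1 t x y * d1 S.u2 t x y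
      + S.u2 t x y * d2 S.u2 t x y)
      - (d1 (d1 S.u2) t x y + d2 (d2 S.u2) t x y) + d2 S.p t x y) _ x :=
    (((((s2.dt.hd1 t x y).add ((s1.hd1 t x y).mul (s2.d1.hd1 t x y))).add
      ((s2.hd1 t x y).mul (s2.d2.hd1 t x y))).const_mul (Pr⁻¹)).sub
      ((s2.d1.d1.hd1 t x y).add (s2.d2.d2.hd1 t x y))).add (sp.d2.hd1 t x y)
  have e2 : (fun x => Pr⁻¹ * (dt S.u2 t x y + S.u1 t x y * d1 S.u2 t x y
      + S.u2 t x y * d2 S.u2 t x y)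
      - (d1 (d1 S.u2) t x y + d2 (d2 S.u2) t x y) + d2 S.p t x y) = fun x => Ra * S.T t x y := by
    funext x; exact S.momentum2 t x y ht hyc
  rw [e2] at m2
  have mom2 := m2.unique ((sT.cmul Ra).hd1 t x y)
  have m1 : HasDerivAt (fun y => Pr⁻¹ * (dt S.u1 t x y + S.u1 t x y * d1 S.u1 t x y
      + S.u2 t x y * d2 S.u1 t x y)
      - (d1 (d1 S.u1) t x y + d2 (d2 S.u1) t x y) + d1 S.p t x y) _ y :=
    (((((s1.dt.hd2 t x y).add ((s1.hd2 t x y).mul (s1.d1.hd2 t x y))).add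
      ((s2.hd2 t x y).mul (s1.d2.hd2 t x y))).const_mul (Pr⁻¹)).sub
      ((s1.d1.d1.hd2 t x y).add (s1.d2.d2.hd2 t x y))).add (sp.d1.hd2 t x y)
  have e1 : (fun y => Pr⁻¹ * (dt S.u1 t x y + S.u1 t x y * d1 S.u1 t x y
      + S.u2 t x y * d2 S.u1 t x y)
      - (d1 (d1 S.u1) t x y + d2 (d2 S.u1) t x y) + d1 S.p t x y) =ᶠ[nhds y] fun _ => 0 := by
    filter_upwards [hnb] with z hz
    exact S.momentum1 t x z ht (Ioo_subset_Icc_self hz)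
  have mom1 := (m1.congr_of_eventuallyEq e1.symm).unique (hasDerivAt_const y 0)
  have hdiv := S.incomp t x y ht hyc
  have w1 : vort S = fun t x y => d1 S.u2 t x y - d2 S.u1 t x y := rfl
  have wt : dt (vort S) t x y = d1 (dt S.u2) t x y - d2 (dt S.u1) t x y := by
    rw [w1, dt_sub s2.d1 s1.d2, dt_d1 s2, dt_d2 s1]
  have wx : d1 (vort S) = fun t x y => d1 (d1 S.u2) t x y - d1 (d2 S.u1) t x y := by
    rw [w1, d1_sub s2.d1 s1.d2]
  have wy : d2 (vort S) = fun t x y => d2 (d1 S.u2) t x y - d2 (d2 S.u1) t x y := by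
    rw [w1, d2_sub s2.d1 s1.d2]
  have wxx : d1 (d1 (vort S)) t x y = d1 (d1 (d1 S.u2)) t x y - d1 (d1 (d2 S.u1)) t x y := by
    rw [wx, d1_sub s2.d1.d1 s1.d2.d1]
  have wyy : d2 (d2 (vort S)) t x y = d2 (d2 (d1 S.u2)) t x y - d2 (d2 (d2 S.u1)) t x y := by
    rw [wy, d2_sub s2.d1.d2 s1.d2.d2]
  rw [wt, wxx, wyy, wx, wy]
  -- commute derivatives
  have k1 : d1 (d2 S.u2) t x y = d2 (d1 S.u2) t x y := by rw [d1_d2 s2]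
  have k2 : d1 (d2 S.u1) t x y = d2 (d1 S.u1) t x y := by rw [d1_d2 s1]
  have k3 : d1 (d2 S.p) t x y = d2 (d1 S.p) t x y := by rw [d1_d2 sp]
  have k4 : d1 (d2 (d2 S.u2)) t x y = d2 (d2 (d1 S.u2)) t x y := by
    rw [d1_d2 s2.d2, d1_d2 s2]
  have k5 : d1 (d1 (d2 S.u1)) t x y = d2 (d1 (d1 S.u1)) t x y := by
    rw [d1_d2 s1, d1_d2 s1.d1]
  rw [k1, k3, k4] at mom2
  rw [k5]
  simp only [k2]
  have hv : d2 S.u2 t x y = - d1 S.u1 t x y := by linarith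
  rw [hv] at mom2 mom1
  linear_combination mom2 - mom1

/-! ### Energy estimate -/

lemma energy_pointwise {a β Ra y U V U1 U2 V1 θ p u11 u22 v11 v22 p1 p2 : ℝ}
    (hβ0 : 0 < β) (hβ1 : β ≤ 1) (y0 : 0 ≤ y) (y1 : y ≤ 1) (hTb : -1 ≤ θ ∧ θ ≤ 1) :
    U * (u11 + u22 - p1 - a * (U * U1 + V * U2)) + V * (v11 + v22 - p2 + Ra * θ
      - a * (U * V1 + V * -U1)) ≤
    (-(a/2) * (U1 * (U ^ 2 + V ^ 2) + U * (2 * U * U1 + 2 * V * V1))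
    + (U1 * U1 + U * u11) + (V1 * V1 + V * v11) - (U1 * p + U * p1)
    + (-(a/2) * (-U1 * (U ^ 2 + V ^ 2) + V * (2 * U * U2 + 2 * V * -U1))
    + (U2 * U2 + U * u22) + (-U1 * -U1 + V * v22) - (-U1 * p + V * p2)
    + β * (2 * U ^ 2 + (2 * y - 1) * (2 * U * U2))
    + (1/4) * (1 * V ^ 2 + y * (2 * V * -U1))))
    + (-(β/8) * (U ^ 2 + V ^ 2) + 4 * Ra ^ 2) := by
  have hθ : θ ^ 2 ≤ 1 := by nlinarith
  have g1 : Ra * θ * V ≤ 4 * Ra ^ 2 + (1/16) * V ^ 2 := by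
    nlinarith [sq_nonneg (8 * Ra * θ - V), mul_le_mul_of_nonneg_left hθ (sq_nonneg Ra)]
  have hy2 : (2 * y - 1) ^ 2 ≤ 1 := by nlinarith
  have g2 : - U2 ^ 2 - β * ((2 * y - 1) * (2 * U * U2)) ≤ β * U ^ 2 := by
    have i1 : - (2 * (2*y-1) * U * U2) ≤ U ^ 2 + U2 ^ 2 := by
      nlinarith [sq_nonneg ((2*y-1) * U + U2), mul_le_mul_of_nonneg_right hy2 (sq_nonneg U)]
    have i2 := mul_le_mul_of_nonneg_left i1 hβ0.le
    have i3 := mul_le_mul_of_nonneg_right hβ1 (sq_nonneg U2)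
    nlinarith
  have g3 : - U1 ^ 2 + (1/2) * (y * (V * U1)) ≤ (1/16) * V ^ 2 := by
    have : y ^ 2 * V ^ 2 ≤ 1 * V ^ 2 :=
      mul_le_mul_of_nonneg_right (by nlinarith) (sq_nonneg V)
    nlinarith [sq_nonneg (U1 - y * V / 4)]
  have g4 : β * V ^ 2 ≤ V ^ 2 := by
    have := mul_le_mul_of_nonneg_right hβ1 (sq_nonneg V); linarith
  have g5 : 0 ≤ β * U ^ 2 := by positivity
  have g6 : 0 ≤ V1 ^ 2 := sq_nonneg _
  have g7 : 0 ≤ U1 ^ 2 := sq_nonneg _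
  have g8 : 0 ≤ V ^ 2 := sq_nonneg _
  linarith [g1, g2, g3, g4, g5, g6, g7, g8]

set_option maxHeartbeats 1000000 in
lemma energy_bound (hΓ : 0 < Γ) (hRa : 0 < Ra) (hPr : 0 < Pr) (S : Sol Γ Ra Pr Ls)
    (hT : T0cond S) {β : ℝ} (hβ0 : 0 < β) (hβ1 : β ≤ 1) (hβ : β ≤ (Ls⁻¹).toReal) :
    ∀ t, 0 ≤ t → intΩ Γ (fun x y => S.u1 t x y ^ 2 + S.u2 t x y ^ 2) ≤
      intΩ Γ (fun x y => S.u1 0 x y ^ 2 + S.u2 0 x y ^ 2) + 32 * Γ * Ra ^ 2 / β := by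
  have s1 := S.smooth_u1
  have s2 := S.smooth_u2
  have sp := S.smooth_p
  set α := (Ls⁻¹).toReal with hα
  set a := Pr⁻¹ with ha'
  have ha : 0 < a := by positivity
  intro t0 ht0
  have hder : ∀ t, HasDerivAt (fun t => intΩ Γ (fun x y => S.u1 t x y ^ 2 + S.u2 t x y ^ 2))
      (intΩ Γ (fun x y => 2 * (S.u1 t x y * dt S.u1 t x y + S.u2 t x y * dt S.u2 t x y))) t := by
    intro t
    have k1 := s1.cont
    have k2 := s2.cont
    have k3 := s1.dt.cont
    have k4 := s2.dt.cont
    refine intΩ_dt (G := fun t x y => S.u1 t x y ^ 2 + S.u2 t x y ^ 2)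
      (G' := fun t x y => 2 * (S.u1 t x y * dt S.u1 t x y + S.u2 t x y * dt S.u2 t x y)) ?_ ?_ ?_ t
    · intro t x y
      have := ((s1.hdt t x y).pow 2).add ((s2.hdt t x y).pow 2)
      refine this.congr_deriv ?_
      push_cast; ring
    · exact (k1.pow 2).add (k2.pow 2)
    · exact continuous_const.mul ((k1.mul k3).add (k2.mul k4))
  refine ode_bound (c := β / (4 * a)) (by positivity)
    (intΩ_nonneg (fun x y => by positivity)) (by positivity) hder ?_ t0 ⟨ht0, le_rfl⟩
  intro t ht
  have cu1 := s1.c2 t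
  have cu2 := s2.c2 t
  have cp := S.smooth_p.c2 t
  have cu1t := s1.dt.c2 t
  have cu2t := s2.dt.c2 t
  have c11 := s1.d1.c2 t
  have c12 := s1.d2.c2 t
  have c21 := s2.d1.c2 t
  have c22 := s2.d2.c2 t
  have c111 := s1.d1.d1.c2 t
  have c122 := s1.d2.d2.c2 t
  have c211 := s2.d1.d1.c2 t
  have c222 := s2.d2.d2.c2 t
  have cp1 := sp.d1.c2 t
  have cp2 := sp.d2.c2 t
  set u : SField := S.u1 t with hu
  set v : SField := S.u2 t with hv
  set p : SField := S.p t with hp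
  set A' : SField := fun x y =>
    -(a/2) * (d1 S.u1 t x y * (u x y ^ 2 + v x y ^ 2)
      + u x y * (2 * u x y * d1 S.u1 t x y + 2 * v x y * d1 S.u2 t x y))
    + (d1 S.u1 t x y * d1 S.u1 t x y + u x y * d1 (d1 S.u1) t x y)
    + (d1 S.u2 t x y * d1 S.u2 t x y + v x y * d1 (d1 S.u2) t x y)
    - (d1 S.u1 t x y * p x y + u x y * d1 S.p t x y) with hA'
  set B' : SField := fun x y =>
    -(a/2) * (d2 S.u2 t x y * (u x y ^ 2 + v x y ^ 2)
      + v x y * (2 * u x y * d2 S.u1 t x y + 2 * v x y * d2 S.u2 t x y))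
    + (d2 S.u1 t x y * d2 S.u1 t x y + u x y * d2 (d2 S.u1) t x y)
    + (d2 S.u2 t x y * d2 S.u2 t x y + v x y * d2 (d2 S.u2) t x y)
    - (d2 S.u2 t x y * p x y + v x y * d2 S.p t x y)
    + β * (2 * u x y ^ 2 + (2 * y - 1) * (2 * u x y * d2 S.u1 t x y))
    + (1/4) * (1 * v x y ^ 2 + y * (2 * v x y * d2 S.u2 t x y)) with hB'
  have cA : Continuous (fun q : ℝ × ℝ => A' q.1 q.2) := by
    simp only [hA']; fun_prop
  have cB : Continuous (fun q : ℝ × ℝ => B' q.1 q.2) := by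
    simp only [hB']; fun_prop
  have sq : ∀ {f : ℝ → ℝ} {f' z : ℝ}, HasDerivAt f f' z →
      HasDerivAt (fun z => f z ^ 2) (2 * f z * f') z := by
    intro f f' z h
    refine (h.pow 2).congr_deriv ?_
    push_cast; ring
  have iA : intΩ Γ A' = 0 := by
    refine intΩ_d1 hΓ (G := fun x y => -(a/2) * (u x y * (u x y ^ 2 + v x y ^ 2))
      + u x y * d1 S.u1 t x y + v x y * d1 S.u2 t x y - u x y * p x y) ?_ cA ?_
    · intro x y
      have h1 := s1.hd1 t x y
      have h2 := s2.hd1 t x y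
      exact ((((h1.mul ((sq h1).add (sq h2))).const_mul (-(a/2))).add
        (h1.mul (s1.d1.hd1 t x y))).add (h2.mul (s2.d1.hd1 t x y))).sub (h1.mul (sp.hd1 t x y))
    · intro x y
      simp only [hu, hv, hp, S.periodic_u1 t x y, S.periodic_u2 t x y, S.periodic_p t x y,
        per_d1 S.periodic_u1 t x y, per_d1 S.periodic_u2 t x y]
  have iB : intΩ Γ B' ≤ 0 := by
    rw [intΩ_d2 (G := fun x y => -(a/2) * (v x y * (u x y ^ 2 + v x y ^ 2))
      + u x y * d2 S.u1 t x y + v x y * d2 S.u2 t x y - v x y * p x y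
      + β * ((2 * y - 1) * u x y ^ 2) + (1/4) * (y * v x y ^ 2)) ?_ cB]
    · refine integral_nonpos (fun x => ?_)
      have b0 : v x 0 = 0 := S.u2_bot t x ht.1
      have b1 : v x 1 = 0 := S.u2_top t x ht.1
      have q0 : d2 S.u1 t x 0 = α * u x 0 := S.slip_bot t x ht.1
      have q1 : d2 S.u1 t x 1 = -α * u x 1 := S.slip_top t x ht.1
      simp only [b0, b1, q0, q1, Pi.zero_apply]
      have := mul_nonneg (sub_nonneg.2 hβ) (sq_nonneg (u x 0))
      have := mul_nonneg (sub_nonneg.2 hβ) (sq_nonneg (u x 1))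
      nlinarith
    · intro x y
      have h1 := s1.hd2 t x y
      have h2 := s2.hd2 t x y
      have hl : HasDerivAt (fun y : ℝ => 2 * y - 1) (2 * 1) y :=
        ((hasDerivAt_id y).const_mul 2).sub_const 1
      refine (((((((h2.mul ((sq h1).add (sq h2))).const_mul (-(a/2))).add
        (h1.mul (s1.d2.hd2 t x y))).add (h2.mul (s2.d2.hd2 t x y))).sub (h2.mul (sp.hd2 t x y))).add
        ((hl.mul (sq h1)).const_mul β)).add (((hasDerivAt_id y).mul (sq h2)).const_mul (1/4))).congr_deriv ?_
      simp only [hB', id, mul_one]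
      rfl
  have key : intΩ Γ (fun x y => (a/2) * (2 * (u x y * dt S.u1 t x y + v x y * dt S.u2 t x y))) ≤
      intΩ Γ (fun x y => (A' x y + B' x y) + (-(β/8) * (u x y ^ 2 + v x y ^ 2) + 4 * Ra ^ 2)) := by
    apply intΩ_mono
    · fun_prop
    · fun_prop
    · intro x y hy
      have h1 := S.momentum1 t x y ht.1 hy
      have h2 := S.momentum2 t x y ht.1 hy
      have h3 := S.incomp t x y ht.1 hy
      have hTb := abs_le.1 (T_bounds hΓ S hT t x y ht.1 hy)
      have h5 : d2 S.u2 t x y = - d1 S.u1 t x y := by linarith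
      have e1 : a * dt S.u1 t x y = d1 (d1 S.u1) t x y + d2 (d2 S.u1) t x y - d1 S.p t x y
        - a * (u x y * d1 S.u1 t x y + v x y * d2 S.u1 t x y) := by
        simp only [hu, hv]; linarith
      have e2 : a * dt S.u2 t x y = d1 (d1 S.u2) t x y + d2 (d2 S.u2) t x y - d2 S.p t x y
        + Ra * S.T t x y - a * (u x y * d1 S.u2 t x y + v x y * d2 S.u2 t x y) := by
        simp only [hu, hv]; linarith
      have e3 : (a/2) * (2 * (u x y * dt S.u1 t x y + v x y * dt S.u2 t x y))
        = u x y * (a * dt S.u1 t x y) + v x y * (a * dt S.u2 t x y) := by ring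
      rw [e3, e1, e2]
      simp only [hA', hB', h5]
      exact energy_pointwise hβ0 hβ1 hy.1 hy.2 hTb
  have c4 : Continuous (fun q : ℝ × ℝ => -(β/8) * (u q.1 q.2 ^ 2 + v q.1 q.2 ^ 2)) := by fun_prop
  rw [intΩ_add Γ (by fun_prop) (by fun_prop), intΩ_add Γ cA cB, iA,
    intΩ_add Γ (f := fun x y => -(β/8) * (u x y ^ 2 + v x y ^ 2)) (g := fun _ _ => 4 * Ra ^ 2)
      c4 continuous_const, intΩ_cmul Γ (a/2), intΩ_cmul Γ (-(β/8)), intΩ_const _ _ hΓ] at key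
  have h7 : intΩ Γ (fun x y => 2 * (u x y * dt S.u1 t x y + v x y * dt S.u2 t x y)) ≤
      (2/a) * (-(β/8) * intΩ Γ (fun x y => u x y ^ 2 + v x y ^ 2) + Γ * (4 * Ra ^ 2)) := by
    have h8 : intΩ Γ (fun x y => 2 * (u x y * dt S.u1 t x y + v x y * dt S.u2 t x y)) =
      (2/a) * (a / 2 * intΩ Γ (fun x y => 2 * (u x y * dt S.u1 t x y + v x y * dt S.u2 t x y))) := by
      field_simp
    rw [h8]
    apply mul_le_mul_of_nonneg_left _ (by positivity)
    linarith
  refine h7.trans (le_of_eq ?_)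
  field_simp
  ring

/-! ### Sup bound of the velocity on the boundary -/

lemma tsmooth.curve {f : TField} (hf : tsmooth f) (t : ℝ) {X Y : ℝ → ℝ} {X' Y' r : ℝ}
    (hX : HasDerivAt X X' r) (hY : HasDerivAt Y Y' r) :
    HasDerivAt (fun r => f t (X r) (Y r))
      (RB.d1 f t (X r) (Y r) * X' + RB.d2 f t (X r) (Y r) * Y') r := by
  have h : HasDerivAt (fun s : ℝ => (t, X s, Y s)) ((0 : ℝ), X', Y') r :=
    (hasDerivAt_const r t).prodMk (hX.prodMk hY)
  have h2 := (hf.hasD (t, X r, Y r)).comp_hasDerivAt r h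
  refine h2.congr_deriv ?_
  have e : ((0 : ℝ), X', Y') = X' • ((0:ℝ), (1:ℝ), (0:ℝ)) + Y' • ((0:ℝ), (0:ℝ), (1:ℝ)) := by
    simp
  rw [e, map_add, map_smul, map_smul]
  have e1 : RB.d1 f t (X r) (Y r) = _ := (hf.d1_eq t (X r) (Y r)).deriv
  have e2 : RB.d2 f t (X r) (Y r) = _ := (hf.d2_eq t (X r) (Y r)).deriv
  rw [e1, e2, smul_eq_mul, smul_eq_mul]; ring

lemma polar_bound {Γ : ℝ} {g : SField}
    (hg : Continuous (fun q : ℝ × ℝ => g q.1 q.2)) (h0 : ∀ x y, 0 ≤ g x y)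
    (hp : ∀ x y, g (x + Γ) y = g x y) (x0 R : ℝ) (hR0 : 0 < R) (hR1 : R ≤ 1) (hR2 : R ≤ Γ / 2) :
    (∫ r in (0:ℝ)..R, ∫ θ in (0:ℝ)..Real.pi,
      r * g (x0 + r * Real.cos θ) (r * Real.sin θ)) ≤ intΩ Γ g := by
  have hΓ : 0 < Γ := by linarith
  set D : Set (ℝ × ℝ) := Ioc (-(Γ/2)) (Γ/2) ×ˢ Ioc (0:ℝ) 1 with hD
  have hDm : MeasurableSet D := measurableSet_Ioc.prod measurableSet_Ioc
  set h : ℝ × ℝ → ℝ := fun p => g (x0 + p.1) p.2 with hh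
  have hc : Continuous h := hg.comp (by fun_prop : Continuous (fun p : ℝ × ℝ => (x0 + p.1, p.2)))
  have hi : IntegrableOn h D := cont_intOn (g := fun x y => g (x0 + x) y) hc _ _ _ _
  set f : ℝ × ℝ → ℝ := D.indicator h with hf
  have hfi : Integrable f := (integrable_indicator_iff hDm).2 hi
  have hf0 : ∀ p, 0 ≤ f p := fun p => Set.indicator_nonneg (fun q _ => h0 _ _) p
  have hfint : ∫ p, f p = intΩ Γ g := by
    rw [hf, integral_indicator hDm, hD, Measure.volume_eq_prod, setIntegral_prod _ (by
      rw [← Measure.volume_eq_prod]; exact hi)]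
    rw [integral_integral_swap (f := fun x y => h (x, y)) (by
      have := hi
      rw [IntegrableOn, hD, Measure.volume_eq_prod, ← Measure.prod_restrict] at this
      exact this), intΩ_swap Γ hg]
    congr 1
    funext y
    have hper : Function.Periodic (fun x => g x y) Γ := fun x => hp x y
    rw [← intervalIntegral.integral_of_le (by linarith), ← intervalIntegral.integral_of_le hΓ.le]
    simp only [hh]
    rw [intervalIntegral.integral_comp_add_left (fun x => g x y) x0]
    have := hper.intervalIntegral_add_eq (x0 + -(Γ/2)) 0
    rw [show x0 + -(Γ/2) + Γ = x0 + Γ/2 by ring, zero_add] at this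
    exact this
  -- the left side as an integral on a product set
  set k : SField := fun r θ => r * g (x0 + r * Real.cos θ) (r * Real.sin θ) with hk
  have hkc : Continuous (fun q : ℝ × ℝ => k q.1 q.2) := by
    refine continuous_fst.mul (hg.comp (by fun_prop :
      Continuous (fun q : ℝ × ℝ => (x0 + q.1 * Real.cos q.2, q.1 * Real.sin q.2))))
  have e1 : (∫ r in (0:ℝ)..R, ∫ θ in (0:ℝ)..Real.pi, k r θ) =
      ∫ q in Ioo (0:ℝ) R ×ˢ Ioo (0:ℝ) Real.pi, k q.1 q.2 := by
    rw [intervalIntegral.integral_of_le hR0.le]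
    simp only [intervalIntegral.integral_of_le Real.pi_pos.le, integral_Ioc_eq_integral_Ioo]
    have hI : IntegrableOn (fun q : ℝ × ℝ => k q.1 q.2) (Ioo (0:ℝ) R ×ˢ Ioo (0:ℝ) Real.pi) :=
      (cont_intOn hkc 0 R 0 Real.pi).mono_set (Set.prod_mono Ioo_subset_Ioc_self Ioo_subset_Ioc_self)
    rw [Measure.volume_eq_prod, setIntegral_prod _ (by
      rw [← Measure.volume_eq_prod]; exact hI)]
  rw [e1, ← hfint]
  have hSm : MeasurableSet (Ioo (0:ℝ) R ×ˢ Ioo (0:ℝ) Real.pi) :=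
    measurableSet_Ioo.prod measurableSet_Ioo
  have hk0 : ∀ q ∈ Ioo (0:ℝ) R ×ˢ Ioo (0:ℝ) Real.pi, 0 ≤ k q.1 q.2 := fun q hq =>
    mul_nonneg hq.1.1.le (h0 _ _)
  rw [integral_eq_lintegral_of_nonneg_ae ((ae_restrict_iff' hSm).2 (Eventually.of_forall hk0))
    hkc.aestronglyMeasurable,
    integral_eq_lintegral_of_nonneg_ae (Eventually.of_forall hf0) hfi.aestronglyMeasurable]
  refine ENNReal.toReal_mono ?_ ?_
  · have := hfi.lintegral_lt_top
    exact this.ne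
  · rw [← lintegral_comp_polarCoord_symm]
    have hsub : Ioo (0:ℝ) R ×ˢ Ioo (0:ℝ) Real.pi ⊆ polarCoord.target := by
      rintro ⟨r, θ⟩ ⟨hr, hθ⟩
      exact ⟨hr.1, ⟨by linarith [hθ.1, Real.pi_pos], hθ.2⟩⟩
    refine le_trans ?_ (lintegral_mono_set hsub)
    refine setLIntegral_mono' hSm ?_
    rintro ⟨r, θ⟩ ⟨hr, hθ⟩
    simp only [mem_Ioo] at hr hθ
    have hs := Real.sin_pos_of_mem_Ioo hθ
    have hs1 := Real.sin_le_one θ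
    have hc1 := Real.cos_le_one θ
    have hc2 := Real.neg_one_le_cos θ
    have hmem : (r * Real.cos θ, r * Real.sin θ) ∈ D := by
      have hcl : Real.cos θ < 1 ∨ True := Or.inr trivial
      refine ⟨⟨?_, ?_⟩, ⟨?_, ?_⟩⟩
      · show -(Γ/2) < r * Real.cos θ
        nlinarith [hr.1, hr.2]
      · show r * Real.cos θ ≤ Γ / 2
        nlinarith [hr.1, hr.2]
      · show 0 < r * Real.sin θ
        exact mul_pos hr.1 hs
      · show r * Real.sin θ ≤ 1
        nlinarith [hr.1, hr.2]
    have e2 : polarCoord.symm (r, θ) = (r * Real.cos θ, r * Real.sin θ) := rfl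
    rw [e2, smul_eq_mul, ← ENNReal.ofReal_mul hr.1.le, hf, Set.indicator_of_mem hmem]

lemma young_w {w r R M : ℝ} (hr : 0 < r) (hrR : r ≤ R) (hM : 0 < M) :
    |w| ≤ (Real.sqrt R / M ^ 3) * (r * w ^ 4) + M * r ^ (-(1/2) : ℝ) := by
  have hs : 0 < Real.sqrt r := Real.sqrt_pos.2 hr
  have hsq : Real.sqrt r ^ 2 = r := Real.sq_sqrt hr.le
  have e : r ^ (-(1/2) : ℝ) = 1 / Real.sqrt r := by
    rw [Real.rpow_neg hr.le, ← Real.sqrt_eq_rpow, one_div]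
  have hsR : Real.sqrt r ≤ Real.sqrt R := Real.sqrt_le_sqrt hrR
  rw [e]
  have hw4 : w ^ 4 = |w| ^ 4 := by
    rw [show (4:ℕ) = 2 * 2 by rfl, pow_mul, pow_mul, sq_abs]
  rw [hw4]
  set z := |w|
  have hz : 0 ≤ z := abs_nonneg w
  by_cases h : z * Real.sqrt r ≤ M
  · have h1 : z ≤ M * (1 / Real.sqrt r) := by
      rw [mul_one_div, le_div_iff₀ hs]; exact h
    have : 0 ≤ Real.sqrt R / M ^ 3 * (r * z ^ 4) := by positivity
    linarith
  · push Not at h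
    have h1 : M ^ 3 ≤ (z * Real.sqrt r) ^ 3 := pow_le_pow_left₀ hM.le h.le 3
    have h2 : (z * Real.sqrt r) ^ 3 = z ^ 3 * r * Real.sqrt r := by
      rw [mul_pow, pow_succ (Real.sqrt r) 2, hsq]; ring
    have h3 : M ^ 3 ≤ z ^ 3 * r * Real.sqrt R := by
      rw [h2] at h1
      exact h1.trans (mul_le_mul_of_nonneg_left hsR (by positivity))
    have h4 : z ≤ Real.sqrt R / M ^ 3 * (r * z ^ 4) := by
      rw [div_mul_eq_mul_div, le_div_iff₀ (by positivity)]
      calc z * M ^ 3 ≤ z * (z ^ 3 * r * Real.sqrt R) := mul_le_mul_of_nonneg_left h3 hz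
        _ = _ := by ring
    have : 0 ≤ M * (1 / Real.sqrt r) := by positivity
    linarith

lemma bdry_bound {Γ : ℝ} {u v : TField} (su : tsmooth u) (sv : tsmooth v)
    (pu : tperiodic Γ u) (pv : tperiodic Γ v) (t : ℝ)
    (hdiv : ∀ x y, y ∈ Icc (0:ℝ) 1 → d1 u t x y + d2 v t x y = 0)
    (hv0 : ∀ x, v t x 0 = 0) {R E M : ℝ} (hR0 : 0 < R) (hR1 : R ≤ 1) (hR2 : R ≤ Γ / 2)
    (hE : 0 < E) (hM : 0 < M)
    (hEi : intΩ Γ (fun x y => u t x y ^ 2) ≤ E ^ 2)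
    (hMi : intΩ Γ (fun x y => (d1 v t x y - d2 u t x y) ^ 4) ≤ M ^ 4) (x0 : ℝ) :
    |u t x0 0| ≤ 3 * (E / R + M * Real.sqrt R) := by
  have hpi := Real.pi_pos
  have hpi3 := Real.pi_gt_three
  set w : SField := fun x y => d1 v t x y - d2 u t x y with hw
  have cpol : ∀ {g : SField}, Continuous (fun q : ℝ × ℝ => g q.1 q.2) →
      Continuous (fun q : ℝ × ℝ => g (x0 + q.1 * Real.cos q.2) (q.1 * Real.sin q.2)) := fun hg =>
    hg.comp (by fun_prop : Continuous (fun q : ℝ × ℝ =>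
      (x0 + q.1 * Real.cos q.2, q.1 * Real.sin q.2)))
  have cw0 : Continuous (fun q : ℝ × ℝ => w q.1 q.2) := (sv.d1.c2 t).sub (su.d2.c2 t)
  have cU := cpol (su.c2 t)
  have cW := cpol cw0
  have cU1 := cpol (su.d1.c2 t)
  have cU2 := cpol (su.d2.c2 t)
  set U : ℝ → ℝ → ℝ := fun r θ => u t (x0 + r * Real.cos θ) (r * Real.sin θ) with hU
  set W : ℝ → ℝ → ℝ := fun r θ => w (x0 + r * Real.cos θ) (r * Real.sin θ) with hW
  set U' : ℝ → ℝ → ℝ := fun r θ => d1 u t (x0 + r * Real.cos θ) (r * Real.sin θ) * Real.cos θ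
    + d2 u t (x0 + r * Real.cos θ) (r * Real.sin θ) * Real.sin θ with hU'
  have cU' : Continuous (fun q : ℝ × ℝ => U' q.1 q.2) := by
    simp only [hU']; fun_prop
  have sec : ∀ {g : ℝ → ℝ → ℝ}, Continuous (fun q : ℝ × ℝ => g q.1 q.2) → ∀ r,
      Continuous (fun θ => g r θ) := fun hg r => hg.comp (by fun_prop : Continuous (fun θ : ℝ => (r, θ)))
  have par : ∀ {g : ℝ → ℝ → ℝ}, Continuous (fun q : ℝ × ℝ => g q.1 q.2) →
      Continuous (fun r => ∫ θ in (0:ℝ)..Real.pi, g r θ) := fun hg =>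
    intervalIntegral.continuous_parametric_intervalIntegral_of_continuous' hg _ _
  have hA : ∀ r, HasDerivAt (fun r => ∫ θ in (0:ℝ)..Real.pi, U r θ)
      (∫ θ in (0:ℝ)..Real.pi, U' r θ) r := by
    intro r
    simp only [intervalIntegral.integral_of_le hpi.le]
    refine hasDerivAt_param (K := Icc 0 Real.pi) isCompact_Icc Ioc_subset_Icc_self measurableSet_Ioc
      ?_ (fun r => sec (g := U) cU r) cU' r
    intro r θ
    have hX : HasDerivAt (fun r : ℝ => x0 + r * Real.cos θ) (Real.cos θ) r := by
      simpa using ((hasDerivAt_id r).mul_const (Real.cos θ)).const_add x0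
    have hY : HasDerivAt (fun r : ℝ => r * Real.sin θ) (Real.sin θ) r := by
      simpa using (hasDerivAt_id r).mul_const (Real.sin θ)
    exact su.curve t hX hY
  -- the circulation identity
  have hA' : ∀ r ∈ Ioc 0 R, (∫ θ in (0:ℝ)..Real.pi, U' r θ) =
      - ∫ θ in (0:ℝ)..Real.pi, Real.sin θ * W r θ := by
    intro r hr
    set V' : ℝ → ℝ := fun θ => d1 v t (x0 + r * Real.cos θ) (r * Real.sin θ) * (r * -Real.sin θ)
      + d2 v t (x0 + r * Real.cos θ) (r * Real.sin θ) * (r * Real.cos θ) with hV'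
    have cV' : Continuous V' := by
      have k1 := sec (g := fun r θ => d1 v t (x0 + r*Real.cos θ) (r*Real.sin θ)) (cpol (sv.d1.c2 t)) r
      have k2 := sec (g := fun r θ => d2 v t (x0 + r*Real.cos θ) (r*Real.sin θ)) (cpol (sv.d2.c2 t)) r
      simp only [hV']; fun_prop
    have hV : ∫ θ in (0:ℝ)..Real.pi, V' θ = 0 := by
      rw [intervalIntegral.integral_eq_sub_of_hasDerivAt
        (f := fun θ => v t (x0 + r * Real.cos θ) (r * Real.sin θ))]
      · simp [hv0]
      · intro θ _
        have hX : HasDerivAt (fun θ : ℝ => x0 + r * Real.cos θ) (r * -Real.sin θ) θ :=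
          ((Real.hasDerivAt_cos θ).const_mul r).const_add x0
        have hY : HasDerivAt (fun θ : ℝ => r * Real.sin θ) (r * Real.cos θ) θ :=
          (Real.hasDerivAt_sin θ).const_mul r
        exact sv.curve t hX hY
      · exact cV'.intervalIntegrable _ _
    have e : ∀ θ ∈ uIcc 0 Real.pi, U' r θ = -(1/r) * V' θ + - (Real.sin θ * W r θ) := by
      intro θ hθ
      rw [uIcc_of_le hpi.le] at hθ
      have hs0 := Real.sin_nonneg_of_mem_Icc hθ
      have hs1 := Real.sin_le_one θ
      have hd := hdiv (x0 + r * Real.cos θ) (r * Real.sin θ)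
        ⟨mul_nonneg hr.1.le hs0, by nlinarith [hr.1, hr.2]⟩
      have hd' : d1 u t (x0 + r * Real.cos θ) (r * Real.sin θ) =
        - d2 v t (x0 + r * Real.cos θ) (r * Real.sin θ) := by linarith
      simp only [hU', hV', hW, hw, hd']
      have := hr.1.ne'
      field_simp
      ring
    have cS : Continuous (fun θ => Real.sin θ * W r θ) := by
      have := sec (g := W) cW r
      exact Real.continuous_sin.mul this
    have cSn : Continuous (fun θ => -(Real.sin θ * W r θ)) := cS.neg
    have cVn : Continuous (fun θ => -(1/r) * V' θ) := continuous_const.mul cV'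
    rw [intervalIntegral.integral_congr e, intervalIntegral.integral_add
      (cVn.intervalIntegrable _ _) (cSn.intervalIntegrable _ _),
      intervalIntegral.integral_const_mul, hV, intervalIntegral.integral_neg]
    ring
  -- absolute bound for the derivative
  have cWa : Continuous (fun q : ℝ × ℝ => |W q.1 q.2|) := cW.abs
  have hA'b : ∀ r ∈ Ioc 0 R, |∫ θ in (0:ℝ)..Real.pi, U' r θ| ≤
      ∫ θ in (0:ℝ)..Real.pi, |W r θ| := by
    intro r hr
    rw [hA' r hr, abs_neg]
    refine (intervalIntegral.abs_integral_le_integral_abs hpi.le).trans ?_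
    have := sec (g := W) cW r
    refine intervalIntegral.integral_mono_on hpi.le ?_ ?_ ?_
    · exact (Real.continuous_sin.mul this).abs.intervalIntegrable _ _
    · exact this.abs.intervalIntegrable _ _
    · intro θ hθ
      rw [abs_mul]
      have := Real.abs_sin_le_one θ
      have := abs_nonneg (W r θ)
      nlinarith
  set Wt := ∫ r in (0:ℝ)..R, ∫ θ in (0:ℝ)..Real.pi, |W r θ| with hWt
  have hWr0 : ∀ r, 0 ≤ ∫ θ in (0:ℝ)..Real.pi, |W r θ| := fun r =>
    intervalIntegral.integral_nonneg hpi.le (fun θ _ => abs_nonneg _)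
  -- pointwise in the radius
  have hstep : ∀ ρ ∈ Icc 0 R, Real.pi * |u t x0 0| ≤ (∫ θ in (0:ℝ)..Real.pi, |U ρ θ|) + Wt := by
    intro ρ hρ
    have hF := intervalIntegral.integral_eq_sub_of_hasDerivAt (a := 0) (b := ρ) (fun r _ => hA r)
      ((par (g := U') cU').intervalIntegrable _ _)
    have hA0 : (∫ θ in (0:ℝ)..Real.pi, U 0 θ) = Real.pi * u t x0 0 := by
      simp [hU]
    have hb1 : |∫ r in (0:ℝ)..ρ, ∫ θ in (0:ℝ)..Real.pi, U' r θ| ≤ Wt := by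
      refine (intervalIntegral.abs_integral_le_integral_abs hρ.1).trans ?_
      calc (∫ r in (0:ℝ)..ρ, |∫ θ in (0:ℝ)..Real.pi, U' r θ|)
          ≤ ∫ r in (0:ℝ)..ρ, ∫ θ in (0:ℝ)..Real.pi, |W r θ| := by
            rw [intervalIntegral.integral_of_le hρ.1, intervalIntegral.integral_of_le hρ.1]
            refine setIntegral_mono_on ?_ ?_ measurableSet_Ioc ?_
            · exact ((par (g := U') cU').abs.intervalIntegrable 0 ρ).1
            · exact ((par (g := fun r θ => |W r θ|) cWa).intervalIntegrable 0 ρ).1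
            · intro r hr
              exact hA'b r ⟨hr.1, hr.2.trans hρ.2⟩
        _ ≤ Wt := by
            refine intervalIntegral.integral_mono_interval le_rfl hρ.1 hρ.2
              (Eventually.of_forall hWr0) ((par (g := fun r θ => |W r θ|) cWa).intervalIntegrable _ _)
    have hb2 : |∫ θ in (0:ℝ)..Real.pi, U ρ θ| ≤ ∫ θ in (0:ℝ)..Real.pi, |U ρ θ| :=
      intervalIntegral.abs_integral_le_integral_abs hpi.le
    rw [hA0] at hF
    have : Real.pi * |u t x0 0| = |Real.pi * u t x0 0| := by rw [abs_mul, abs_of_pos hpi]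
    rw [this]
    have e : Real.pi * u t x0 0 = (∫ θ in (0:ℝ)..Real.pi, U ρ θ) -
      ∫ r in (0:ℝ)..ρ, ∫ θ in (0:ℝ)..Real.pi, U' r θ := by linarith
    rw [e]
    exact (abs_sub _ _).trans (add_le_add hb2 hb1)
  -- bound for Wt
  have c4 : Continuous (fun q : ℝ × ℝ => q.1 * W q.1 q.2 ^ 4) := by fun_prop
  have hWtb : Wt ≤ M * Real.sqrt R * (1 + 2 * Real.pi) := by
    have hpol := polar_bound (g := fun x y => w x y ^ 4) (cw0.pow 4) (fun x y => by positivity)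
      (fun x y => by simp only [hw, per_d1 pv t x y, per_d2 pu t x y]) x0 R hR0 hR1 hR2
    have hpol' : (∫ r in (0:ℝ)..R, ∫ θ in (0:ℝ)..Real.pi, r * W r θ ^ 4) ≤ M ^ 4 := hpol.trans hMi
    have hrp : IntervalIntegrable (fun r : ℝ => r ^ (-(1/2) : ℝ)) volume 0 R :=
      intervalIntegral.intervalIntegrable_rpow' (by norm_num)
    have hle : Wt ≤ ∫ r in (0:ℝ)..R, ((Real.sqrt R / M ^ 3) *
        (∫ θ in (0:ℝ)..Real.pi, r * W r θ ^ 4) + (M * Real.pi) * r ^ (-(1/2) : ℝ)) := by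
      rw [hWt, intervalIntegral.integral_of_le hR0.le, intervalIntegral.integral_of_le hR0.le]
      refine setIntegral_mono_on ?_ ?_ measurableSet_Ioc ?_
      · exact ((par (g := fun r θ => |W r θ|) cWa).intervalIntegrable 0 R).1
      · exact ((((par (g := fun r θ => r * W r θ ^ 4) c4).intervalIntegrable 0 R).const_mul _).add (hrp.const_mul _)).1
      · intro r hr
        have c5 : Continuous (fun θ => r * W r θ ^ 4) := sec (g := fun r θ => r * W r θ ^ 4) c4 r
        calc (∫ θ in (0:ℝ)..Real.pi, |W r θ|)
            ≤ ∫ θ in (0:ℝ)..Real.pi, ((Real.sqrt R / M ^ 3) * (r * W r θ ^ 4)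
              + M * r ^ (-(1/2) : ℝ)) := by
              refine intervalIntegral.integral_mono_on hpi.le ?_ ?_ ?_
              · exact (sec (g := fun r θ => |W r θ|) cWa r).intervalIntegrable _ _
              · exact ((c5.const_mul _).add continuous_const).intervalIntegrable _ _
              · intro θ _
                exact young_w hr.1 hr.2 hM
          _ = _ := by
              rw [intervalIntegral.integral_add ((c5.const_mul _).intervalIntegrable _ _)
                (continuous_const.intervalIntegrable _ _), intervalIntegral.integral_const_mul,
                intervalIntegral.integral_const]
              simp only [sub_zero, smul_eq_mul]; ring
    rw [intervalIntegral.integral_add (((par (g := fun r θ => r * W r θ ^ 4) c4).intervalIntegrable 0 R).const_mul _)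
      (hrp.const_mul _), intervalIntegral.integral_const_mul, intervalIntegral.integral_const_mul,
      integral_rpow (Or.inl (by norm_num))] at hle
    have e3 : (R ^ (-(1/2) + 1 : ℝ) - 0 ^ (-(1/2) + 1 : ℝ)) / (-(1/2) + 1 : ℝ) = 2 * Real.sqrt R := by
      rw [Real.zero_rpow (by norm_num), Real.sqrt_eq_rpow]; norm_num; ring
    rw [e3] at hle
    have e4 : Real.sqrt R / M ^ 3 * (∫ r in (0:ℝ)..R, ∫ θ in (0:ℝ)..Real.pi, r * W r θ ^ 4) ≤
        Real.sqrt R * M := by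
      calc _ ≤ Real.sqrt R / M ^ 3 * M ^ 4 := mul_le_mul_of_nonneg_left hpol' (by positivity)
        _ = _ := by field_simp
    linarith
  -- averaged bound of U
  have cUa : Continuous (fun q : ℝ × ℝ => |U q.1 q.2|) := cU.abs
  have c2 : Continuous (fun q : ℝ × ℝ => q.1 * U q.1 q.2 ^ 2) := continuous_fst.mul (cU.pow 2)
  have hpolU : (∫ r in (0:ℝ)..R, ∫ θ in (0:ℝ)..Real.pi, r * U r θ ^ 2) ≤ E ^ 2 :=
    (polar_bound (g := fun x y => u t x y ^ 2) ((su.c2 t).pow 2) (fun x y => by positivity)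
      (fun x y => by simp only [pu t x y]) x0 R hR0 hR1 hR2).trans hEi
  have hUb : ∀ r ∈ Icc 0 R, r * (∫ θ in (0:ℝ)..Real.pi, |U r θ|) ≤
      (R / (2 * E)) * (∫ θ in (0:ℝ)..Real.pi, r * U r θ ^ 2) + (E / (2 * R)) * Real.pi * r := by
    intro r hr
    have c5 : Continuous (fun θ => r * U r θ ^ 2) := sec (g := fun r θ => r * U r θ ^ 2) c2 r
    calc r * (∫ θ in (0:ℝ)..Real.pi, |U r θ|) = ∫ θ in (0:ℝ)..Real.pi, r * |U r θ| := by
          rw [intervalIntegral.integral_const_mul]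
      _ ≤ ∫ θ in (0:ℝ)..Real.pi, ((R / (2 * E)) * (r * U r θ ^ 2) + (E / (2 * R)) * r) := by
          refine intervalIntegral.integral_mono_on hpi.le ?_ ?_ ?_
          · exact ((sec (g := fun r θ => |U r θ|) cUa r).const_mul _).intervalIntegrable _ _
          · exact ((c5.const_mul _).add continuous_const).intervalIntegrable _ _
          · intro θ _
            have h1 : |U r θ| ≤ R / (2 * E) * U r θ ^ 2 + E / (2 * R) := by
              rw [← sq_abs (U r θ)]
              have h2 : R / (2 * E) * |U r θ| ^ 2 + E / (2 * R) - |U r θ|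
                = (R * |U r θ| - E) ^ 2 / (2 * E * R) := by field_simp; ring
              have h3 : 0 ≤ (R * |U r θ| - E) ^ 2 / (2 * E * R) := by positivity
              linarith
            have := mul_le_mul_of_nonneg_left h1 hr.1
            linarith
      _ = _ := by
          rw [intervalIntegral.integral_add ((c5.const_mul _).intervalIntegrable _ _)
            (continuous_const.intervalIntegrable _ _), intervalIntegral.integral_const_mul,
            intervalIntegral.integral_const]
          simp only [sub_zero, smul_eq_mul]; ring
  have hfin : (∫ r in (0:ℝ)..R, (Real.pi * |u t x0 0|) * r) ≤
      ∫ r in (0:ℝ)..R, ((R / (2 * E)) * (∫ θ in (0:ℝ)..Real.pi, r * U r θ ^ 2)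
        + ((E / (2 * R)) * Real.pi + Wt) * r) := by
    refine intervalIntegral.integral_mono_on hR0.le ?_ ?_ ?_
    · exact (continuous_id.const_mul _).intervalIntegrable _ _
    · exact (((par (g := fun r θ => r * U r θ ^ 2) c2).const_mul _).add (continuous_id.const_mul _)).intervalIntegrable _ _
    · intro r hr
      have h1 := mul_le_mul_of_nonneg_right (hstep r hr) hr.1
      have h2 := hUb r hr
      linarith
  have cid : ∀ c : ℝ, Continuous (fun r : ℝ => c * r) := fun c => continuous_const.mul continuous_id
  rw [intervalIntegral.integral_add (((par (g := fun r θ => r * U r θ ^ 2) c2).const_mul _).intervalIntegrable _ _)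
      ((cid _).intervalIntegrable _ _), intervalIntegral.integral_const_mul,
      intervalIntegral.integral_const_mul, intervalIntegral.integral_const_mul, integral_id] at hfin
  have h5 : R / (2 * E) * (∫ r in (0:ℝ)..R, ∫ θ in (0:ℝ)..Real.pi, r * U r θ ^ 2) ≤ R * E / 2 := by
    calc _ ≤ R / (2 * E) * E ^ 2 := mul_le_mul_of_nonneg_left hpolU (by positivity)
      _ = _ := by field_simp
  have h6 : Real.pi * |u t x0 0| * (R ^ 2 / 2) ≤
      (E / R + E / (2 * R) * Real.pi + M * Real.sqrt R * (1 + 2 * Real.pi)) * (R ^ 2 / 2) := by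
    have h7 : (E / (2 * R) * Real.pi + Wt) * (R ^ 2 / 2) ≤
      (E / (2 * R) * Real.pi + M * Real.sqrt R * (1 + 2 * Real.pi)) * (R ^ 2 / 2) :=
      mul_le_mul_of_nonneg_right (by linarith) (by positivity)
    have h8 : R * E / 2 = E / R * (R ^ 2 / 2) := by field_simp
    have h9 : (R ^ 2 - 0 ^ 2) / 2 = R ^ 2 / 2 := by ring
    rw [h9] at hfin
    linarith
  have h10 := le_of_mul_le_mul_right h6 (by positivity)
  have hER : 0 ≤ E / R := by positivity
  have hMR : 0 ≤ M * Real.sqrt R := by positivity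
  have h11 : E / (2 * R) = E / R / 2 := by field_simp
  rw [h11] at h10
  have h12 : Real.pi * |u t x0 0| ≤ Real.pi * (3 * (E / R + M * Real.sqrt R)) := by nlinarith
  exact le_of_mul_le_mul_left h12 hpi

/-! ### Boundary bounds, and conclusion -/

lemma intΩ_refl (Γ : ℝ) (g : SField) : intΩ Γ (fun x y => g x (1 - y)) = intΩ Γ g := by
  unfold intΩ
  congr 1
  funext x
  rw [← intervalIntegral.integral_of_le zero_le_one, ← intervalIntegral.integral_of_le zero_le_one,
    intervalIntegral.integral_comp_sub_left (fun y => g x y) 1]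
  simp

lemma tsmooth.refl {f : TField} (hf : tsmooth f) : tsmooth (fun t x y => f t x (1 - y)) := by
  unfold tsmooth at hf ⊢
  exact hf.comp (by fun_prop : ContDiff ℝ (⊤ : ℕ∞)
    (fun q : ℝ × ℝ × ℝ => (q.1, q.2.1, 1 - q.2.2)))

lemma d2_refl (f : TField) (t x y : ℝ) :
    d2 (fun t x y => f t x (1 - y)) t x y = - d2 f t x (1 - y) := by
  unfold d2
  exact deriv_comp_const_sub (f := fun s => f t x s) 1 y

lemma bdry_bound_top {Γ : ℝ} {u v : TField} (su : tsmooth u) (sv : tsmooth v)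
    (pu : tperiodic Γ u) (pv : tperiodic Γ v) (t : ℝ)
    (hdiv : ∀ x y, y ∈ Icc (0:ℝ) 1 → d1 u t x y + d2 v t x y = 0)
    (hv1 : ∀ x, v t x 1 = 0) {R E M : ℝ} (hR0 : 0 < R) (hR1 : R ≤ 1) (hR2 : R ≤ Γ / 2)
    (hE : 0 < E) (hM : 0 < M)
    (hEi : intΩ Γ (fun x y => u t x y ^ 2) ≤ E ^ 2)
    (hMi : intΩ Γ (fun x y => (d1 v t x y - d2 u t x y) ^ 4) ≤ M ^ 4) (x0 : ℝ) :
    |u t x0 1| ≤ 3 * (E / R + M * Real.sqrt R) := by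
  have e1 : ∀ x y, d1 (fun t x y => - v t x (1 - y)) t x y = - d1 v t x (1 - y) := by
    intro x y; simp [d1]
  have e2 : ∀ x y, d2 (fun t x y => - v t x (1 - y)) t x y = d2 v t x (1 - y) := by
    intro x y
    have := d2_refl (fun t x y => - v t x y) t x y
    rw [this]; simp [d2]
  have h := bdry_bound (u := fun t x y => u t x (1 - y)) (v := fun t x y => - v t x (1 - y))
    su.refl sv.refl.neg (fun t x y => pu t x (1 - y))
    (fun t x y => by simp only [pv t x (1 - y)]) t
    (fun x y hy => by
      rw [e2]
      exact hdiv x (1 - y) ⟨by linarith [hy.2], by linarith [hy.1]⟩)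
    (fun x => by simp [hv1]) hR0 hR1 hR2 hE hM
    (by rw [intΩ_refl Γ (fun x y => u t x y ^ 2)]; exact hEi)
    (by
      have : (fun x y => (d1 (fun t x y => - v t x (1 - y)) t x y -
          d2 (fun t x y => u t x (1 - y)) t x y) ^ 4) =
          (fun x y => (d1 v t x (1 - y) - d2 u t x (1 - y)) ^ 4) := by
        funext x y
        rw [e1, d2_refl]; ring
      rw [this, intΩ_refl Γ (fun x y => (d1 v t x y - d2 u t x y) ^ 4)]; exact hMi) x0
  simpa using h

lemma vort_top (S : Sol Γ Ra Pr Ls) (t x : ℝ) (ht : 0 ≤ t) :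
    vort S t x 1 = (Ls⁻¹).toReal * S.u1 t x 1 := by
  have : d1 S.u2 t x 1 = 0 := by
    unfold d1; simp [S.u2_top t _ ht]
  unfold vort
  rw [this, S.slip_top t x ht]; ring

lemma vort_bot (S : Sol Γ Ra Pr Ls) (t x : ℝ) (ht : 0 ≤ t) :
    vort S t x 0 = -((Ls⁻¹).toReal * S.u1 t x 0) := by
  have : d1 S.u2 t x 0 = 0 := by
    unfold d1; simp [S.u2_bot t _ ht]
  unfold vort
  rw [this, S.slip_bot t x ht]; ring

lemma pow4_trunc (w Λ : ℝ) :
    w ^ 4 ≤ 8 * ((max (w - Λ) 0) ^ 4 + ((max (-w - Λ) 0) ^ 4 + Λ ^ 4)) := by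
  have key : ∀ a b : ℝ, (a + b) ^ 4 ≤ 8 * (a ^ 4 + b ^ 4) := by
    intro a b
    nlinarith [sq_nonneg (a - b), sq_nonneg (a ^ 2 - b ^ 2), sq_nonneg ((a - b) ^ 2),
      sq_nonneg (a + b), mul_nonneg (sq_nonneg (a - b)) (sq_nonneg (a + b)),
      mul_nonneg (sq_nonneg (a - b)) (sq_nonneg a), mul_nonneg (sq_nonneg (a - b)) (sq_nonneg b)]
  have p1 : 0 ≤ (max (w - Λ) 0) ^ 4 := by positivity
  have p2 : 0 ≤ (max (-w - Λ) 0) ^ 4 := by positivity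
  have p3 : 0 ≤ Λ ^ 4 := by positivity
  by_cases h1 : Λ ≤ w
  · have := key (w - Λ) Λ
    rw [max_eq_left (by linarith : (0:ℝ) ≤ w - Λ)]
    rw [sub_add_cancel] at this
    linarith
  by_cases h2 : Λ ≤ -w
  · have := key (-w - Λ) Λ
    rw [max_eq_left (by linarith : (0:ℝ) ≤ -w - Λ)]
    rw [sub_add_cancel] at this
    have e : (-w) ^ 4 = w ^ 4 := by ring
    linarith
  · push Not at h1 h2
    have hL : |w| ≤ Λ := abs_le.2 ⟨by linarith, h1.le⟩
    have : |w| ^ 4 ≤ Λ ^ 4 := pow_le_pow_left₀ (abs_nonneg w) hL 4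
    have e : |w| ^ 4 = w ^ 4 := by
      rw [show (4:ℕ) = 2 * 2 by rfl, pow_mul, pow_mul, sq_abs]
    linarith

lemma trunc_le (w Λ : ℝ) (hΛ : 0 ≤ Λ) : (max (w - Λ) 0) ^ 4 ≤ w ^ 4 := by
  have e : |w| ^ 4 = w ^ 4 := by
    rw [show (4:ℕ) = 2 * 2 by rfl, pow_mul, pow_mul, sq_abs]
  rw [← e]
  exact pow_le_pow_left₀ (le_max_right _ _)
    (max_le (by linarith [le_abs_self w]) (abs_nonneg w)) 4

lemma vort_trunc (hΓ : 0 < Γ) (hRa : 0 < Ra) (hPr : 0 < Pr) (S : Sol Γ Ra Pr Ls)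
    (hT : T0cond S) {Λ t0 : ℝ} (hΛ : 0 ≤ Λ)
    (hb0 : ∀ t ∈ Icc 0 t0, ∀ x, |vort S t x 0| ≤ Λ)
    (hb1 : ∀ t ∈ Icc 0 t0, ∀ x, |vort S t x 1| ≤ Λ) :
    ∀ t ∈ Icc 0 t0, intΩ Γ (fun x y => vort S t x y ^ 4) ≤
      16 * intΩ Γ (fun x y => vort S 0 x y ^ 4) + 576 * Γ * Ra ^ 4 + 8 * Γ * Λ ^ 4 := by
  intro t ht
  have sv := vort_smooth S
  have n1 : ∀ f : TField, d1 (fun t x y => - f t x y) = fun t x y => - d1 f t x y := by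
    intro f; funext t x y; simp [d1]
  have n2 : ∀ f : TField, d2 (fun t x y => - f t x y) = fun t x y => - d2 f t x y := by
    intro f; funext t x y; simp [d2]
  have n3 : ∀ f : TField, dt (fun t x y => - f t x y) = fun t x y => - dt f t x y := by
    intro f; funext t x y; simp [dt]
  have hPi : 0 < Pr⁻¹ := inv_pos.2 hPr
  have sF : tsmooth (fun t x y => Ra * S.T t x y) := S.smooth_T.cmul Ra
  have hFK : ∀ t x y, 0 ≤ t → y ∈ Icc (0:ℝ) 1 → |Ra * S.T t x y| ≤ Ra := by
    intro t x y h1 h2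
    rw [abs_mul, abs_of_pos hRa]
    have := T_bounds hΓ S hT t x y h1 h2
    nlinarith
  have pF : tperiodic Γ (fun t x y => Ra * S.T t x y) := fun t x y => by
    simp only [S.periodic_T t x y]
  have hp := trunc_energy (K := Ra) (Λ := Λ) (t0 := t0) hΓ hPi S.smooth_u1 S.smooth_u2 sv sF
    S.periodic_u1 (vort_periodic S) pF S.incomp (vort_eq S) hFK
    (fun t ht x => (le_abs_self _).trans (hb0 t ht x))
    (fun t ht x => (le_abs_self _).trans (hb1 t ht x)) t ht
  have hn := trunc_energy (K := Ra) (Λ := Λ) (t0 := t0) (θ := fun t x y => - vort S t x y)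
    (F := fun t x y => - (Ra * S.T t x y)) hΓ hPi S.smooth_u1 S.smooth_u2 sv.neg sF.neg
    S.periodic_u1 (fun t x y => by simp only [vort_periodic S t x y])
    (fun t x y => by simp only [S.periodic_T t x y]) S.incomp
    (fun t x y h1 h2 => by
      have h := vort_eq S t x y h1 h2
      simp only [n1, n2, n3]
      linarith) (fun t x y h1 h2 => by rw [abs_neg]; exact hFK t x y h1 h2)
    (fun t ht x => (neg_le_abs _).trans (hb0 t ht x))
    (fun t ht x => (neg_le_abs _).trans (hb1 t ht x)) t ht
  have cv : ∀ s, Continuous (fun q : ℝ × ℝ => vort S s q.1 q.2) := fun s => sv.c2 s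
  have cp : ∀ s, Continuous (fun q : ℝ × ℝ => (max (vort S s q.1 q.2 - Λ) 0) ^ 4) := fun s =>
    (((cv s).sub continuous_const).max continuous_const).pow 4
  have cn : ∀ s, Continuous (fun q : ℝ × ℝ => (max (-vort S s q.1 q.2 - Λ) 0) ^ 4) := fun s =>
    (((cv s).neg.sub continuous_const).max continuous_const).pow 4
  have c0 : Continuous (fun q : ℝ × ℝ => vort S 0 q.1 q.2 ^ 4) := (cv 0).pow 4
  have i1 : intΩ Γ (fun x y => (max (vort S 0 x y - Λ) 0) ^ 4) ≤
      intΩ Γ (fun x y => vort S 0 x y ^ 4) :=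
    intΩ_mono (cp 0) c0 (fun x y _ => trunc_le _ _ hΛ)
  have i2 : intΩ Γ (fun x y => (max (-vort S 0 x y - Λ) 0) ^ 4) ≤
      intΩ Γ (fun x y => vort S 0 x y ^ 4) :=
    intΩ_mono (cn 0) c0 (fun x y _ => (trunc_le _ _ hΛ).trans (le_of_eq (by ring)))
  have i3 : intΩ Γ (fun x y => vort S t x y ^ 4) ≤
      intΩ Γ (fun x y => 8 * ((max (vort S t x y - Λ) 0) ^ 4 +
        ((max (-vort S t x y - Λ) 0) ^ 4 + Λ ^ 4))) :=
    intΩ_mono ((cv t).pow 4)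
      (continuous_const.mul ((cp t).add ((cn t).add continuous_const)))
      (fun x y _ => pow4_trunc _ _)
  rw [intΩ_cmul Γ 8 (f := fun x y => (max (vort S t x y - Λ) 0) ^ 4 +
        ((max (-vort S t x y - Λ) 0) ^ 4 + Λ ^ 4)),
    intΩ_add Γ (f := fun x y => (max (vort S t x y - Λ) 0) ^ 4)
      (g := fun x y => (max (-vort S t x y - Λ) 0) ^ 4 + Λ ^ 4) (cp t)
      ((cn t).add continuous_const),
    intΩ_add Γ (f := fun x y => (max (-vort S t x y - Λ) 0) ^ 4)
      (g := fun _ _ => Λ ^ 4) (cn t) continuous_const, intΩ_const Γ _ hΓ] at i3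
  linarith

lemma W14_nonneg (S : Sol Γ Ra Pr Ls) : 0 ≤ W14u0 S := by
  unfold W14u0
  exact Real.rpow_nonneg (intΩ_nonneg fun x y => by positivity) _

lemma rpow_quarter {a : ℝ} (ha : 0 ≤ a) : (a ^ ((1:ℝ)/4)) ^ 4 = a := by
  rw [← Real.rpow_natCast, ← Real.rpow_mul ha]; norm_num

lemma gradSq_cont (S : Sol Γ Ra Pr Ls) :
    Continuous (fun q : ℝ × ℝ => gradSq S 0 q.1 q.2) := by
  unfold gradSq
  exact ((((S.smooth_u1.d1.c2 0).pow 2).add ((S.smooth_u1.d2.c2 0).pow 2)).add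
    ((S.smooth_u2.d1.c2 0).pow 2)).add ((S.smooth_u2.d2.c2 0).pow 2)

lemma ucont (S : Sol Γ Ra Pr Ls) (t : ℝ) :
    Continuous (fun q : ℝ × ℝ => S.u1 t q.1 q.2 ^ 2 + S.u2 t q.1 q.2 ^ 2) :=
  ((S.smooth_u1.c2 t).pow 2).add ((S.smooth_u2.c2 t).pow 2)

lemma W14_pow (S : Sol Γ Ra Pr Ls) : W14u0 S ^ 4 = intΩ Γ (fun x1 x2 =>
    (S.u1 0 x1 x2 ^ 2 + S.u2 0 x1 x2 ^ 2) ^ 2 + (gradSq S 0 x1 x2) ^ 2) := by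
  unfold W14u0
  exact rpow_quarter (intΩ_nonneg fun x y => by positivity)

lemma W14_cont (S : Sol Γ Ra Pr Ls) : Continuous (fun q : ℝ × ℝ =>
    (S.u1 0 q.1 q.2 ^ 2 + S.u2 0 q.1 q.2 ^ 2) ^ 2 + (gradSq S 0 q.1 q.2) ^ 2) :=
  ((ucont S 0).pow 2).add ((gradSq_cont S).pow 2)

lemma vort0_le (S : Sol Γ Ra Pr Ls) :
    intΩ Γ (fun x y => vort S 0 x y ^ 4) ≤ 4 * W14u0 S ^ 4 := by
  rw [W14_pow, ← intΩ_cmul]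
  refine intΩ_mono (((vort_smooth S).c2 0).pow 4) (continuous_const.mul (W14_cont S)) ?_
  intro x y _
  have h1 : vort S 0 x y ^ 2 ≤ 2 * gradSq S 0 x y := by
    unfold vort gradSq
    nlinarith [sq_nonneg (d1 S.u2 0 x y + d2 S.u1 0 x y), sq_nonneg (d1 S.u1 0 x y),
      sq_nonneg (d2 S.u2 0 x y)]
  have h2 : (vort S 0 x y ^ 2) ^ 2 ≤ (2 * gradSq S 0 x y) ^ 2 :=
    pow_le_pow_left₀ (sq_nonneg _) h1 2
  have h3 := sq_nonneg (S.u1 0 x y ^ 2 + S.u2 0 x y ^ 2)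
  have e : vort S 0 x y ^ 4 = (vort S 0 x y ^ 2) ^ 2 := by ring
  rw [e]
  linarith

lemma energy0_le (hΓ : 0 < Γ) (hRa : 0 < Ra) (S : Sol Γ Ra Pr Ls) :
    intΩ Γ (fun x y => S.u1 0 x y ^ 2 + S.u2 0 x y ^ 2) ≤ (1 + Γ) * (W14u0 S + Ra) ^ 2 := by
  have hW := W14_nonneg S
  set D := W14u0 S + Ra with hD
  have hD0 : 0 < D := by linarith
  have h : intΩ Γ (fun x y => S.u1 0 x y ^ 2 + S.u2 0 x y ^ 2) ≤
      intΩ Γ (fun x y => (D ^ 2)⁻¹ * ((S.u1 0 x y ^ 2 + S.u2 0 x y ^ 2) ^ 2 +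
        (gradSq S 0 x y) ^ 2) + D ^ 2) := by
    refine intΩ_mono (ucont S 0) ((continuous_const.mul (W14_cont S)).add continuous_const) ?_
    intro x y _
    set z := S.u1 0 x y ^ 2 + S.u2 0 x y ^ 2
    have hD2 : 0 < D ^ 2 := by positivity
    have h1 : (D ^ 2)⁻¹ * (z ^ 2 + gradSq S 0 x y ^ 2) + D ^ 2 - z
        = (D ^ 2)⁻¹ * ((z - D ^ 2 / 2) ^ 2 + gradSq S 0 x y ^ 2 + 3 / 4 * (D ^ 2) ^ 2) := by
      field_simp; ring
    have h2 : 0 ≤ (D ^ 2)⁻¹ * ((z - D ^ 2 / 2) ^ 2 + gradSq S 0 x y ^ 2 + 3 / 4 * (D ^ 2) ^ 2) := by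
      positivity
    linarith
  rw [intΩ_add Γ (f := fun x y => (D ^ 2)⁻¹ * ((S.u1 0 x y ^ 2 + S.u2 0 x y ^ 2) ^ 2 +
        (gradSq S 0 x y) ^ 2)) (g := fun _ _ => D ^ 2) (continuous_const.mul (W14_cont S))
        continuous_const, intΩ_const Γ _ hΓ, intΩ_cmul, ← W14_pow] at h
  have h4 : W14u0 S ^ 4 ≤ D ^ 4 := pow_le_pow_left₀ hW (by linarith) 4
  have h5 : (D ^ 2)⁻¹ * W14u0 S ^ 4 ≤ (D ^ 2)⁻¹ * D ^ 4 :=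
    mul_le_mul_of_nonneg_left h4 (by positivity)
  have h6 : (D ^ 2)⁻¹ * D ^ 4 = D ^ 2 := by field_simp
  linarith

lemma m_bound (hΓ : 0 < Γ) {W R' I0 Λ m : ℝ} (hW : 0 ≤ W) (hR : 0 < R') (hΛ : 0 ≤ Λ) (hm : 0 ≤ m)
    (hI : I0 ≤ 4 * W ^ 4) (h : m ^ 4 ≤ 16 * I0 + 576 * Γ * R' ^ 4 + 8 * Γ * Λ ^ 4) :
    m ≤ 640 * (1 + Γ) * (W + R' + Λ) := by
  set c := 640 * (1 + Γ) with hc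
  have hc1 : 1 ≤ c := by rw [hc]; linarith
  have hc4 : c ≤ c ^ 4 := le_self_pow₀ hc1 (by norm_num)
  have h1 : W ^ 4 ≤ (W + R') ^ 4 := pow_le_pow_left₀ hW (by linarith) 4
  have h2 : R' ^ 4 ≤ (W + R') ^ 4 := pow_le_pow_left₀ hR.le (by linarith) 4
  have h3 : (W + R') ^ 4 + Λ ^ 4 ≤ (W + R' + Λ) ^ 4 := by
    have hD : 0 ≤ W + R' := by linarith
    set D := W + R'
    have e : (D + Λ) ^ 4 = D ^ 4 + Λ ^ 4 + (4 * D ^ 3 * Λ + 6 * D ^ 2 * Λ ^ 2 + 4 * D * Λ ^ 3) := by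
      ring
    have : 0 ≤ 4 * D ^ 3 * Λ + 6 * D ^ 2 * Λ ^ 2 + 4 * D * Λ ^ 3 := by positivity
    linarith
  have h5 : Γ * R' ^ 4 ≤ Γ * (W + R') ^ 4 := mul_le_mul_of_nonneg_left h2 hΓ.le
  have h6 : 0 ≤ Γ * (W + R') ^ 4 := by positivity
  have h7 : 0 ≤ Λ ^ 4 := by positivity
  have h8 : 0 ≤ Γ * Λ ^ 4 := by positivity
  have h9 : 0 ≤ (W + R') ^ 4 := by positivity
  have h4 : m ^ 4 ≤ c * ((W + R') ^ 4 + Λ ^ 4) := by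
    rw [hc]; nlinarith
  have h10 : m ^ 4 ≤ (c * (W + R' + Λ)) ^ 4 := by
    rw [mul_pow]
    exact h4.trans (mul_le_mul hc4 h3 (by positivity) (by positivity))
  exact le_of_pow_le_pow_left₀ (by norm_num) (by positivity) h10

/-- The constant of the theorem. -/
def cst (Γ : ℝ) : ℝ := 3 * (640 * (1 + Γ)) +
  6 * (640 * (1 + Γ)) * (40 * (1 + Γ)) * (37 * (640 * (1 + Γ)) ^ 2) / min 1 (Γ / 2)

lemma vort_cont (S : Sol Γ Ra Pr Ls) :
    Continuous (fun s => intΩ Γ (fun x y => vort S s x y ^ 4)) := by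
  rw [continuous_iff_continuousAt]
  intro t
  have sv := vort_smooth S
  exact (intΩ_dt (G := fun t x y => vort S t x y ^ 4)
    (G' := fun t x y => 4 * vort S t x y ^ 3 * dt (vort S) t x y)
    (fun t x y => by simpa using (sv.hdt t x y).fun_pow 4)
    (sv.cont.pow 4) ((continuous_const.mul (sv.cont.pow 3)).mul sv.dt.cont) t).continuousAt

set_option maxHeartbeats 1000000 in
lemma main_bound (hΓ : 0 < Γ) (hRa : 0 < Ra) (hPr : 0 < Pr) (S : Sol Γ Ra Pr Ls)
    (hT : T0cond S) (t0 : ℝ) (ht0 : 0 ≤ t0) :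
    omegaL4 S t0 ≤ cst Γ * max 1 ((Ls⁻¹).toReal ^ 3) * (W14u0 S + Ra) := by
  have hα : 0 ≤ (Ls⁻¹).toReal := ENNReal.toReal_nonneg
  have hbot := vort_bot S
  have htop := vort_top S
  have hen := fun β => energy_bound (β := β) hΓ hRa hPr S hT
  set α := (Ls⁻¹).toReal with hαd
  have hW := W14_nonneg S
  set W := W14u0 S with hWd
  set D := W + Ra with hD
  have hD0 : 0 < D := by linarith
  set C1 := 640 * (1 + Γ) with hC1
  have hC1p : 1 ≤ C1 := by rw [hC1]; linarith
  set R0 := min 1 (Γ / 2) with hR0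
  have hR01 : R0 ≤ 1 := min_le_left _ _
  have hR02 : R0 ≤ Γ / 2 := min_le_right _ _
  have hR0p : 0 < R0 := lt_min one_pos (by linarith)
  set I : ℝ → ℝ := fun s => intΩ Γ (fun x y => vort S s x y ^ 4) with hI
  have hI0 : ∀ s, 0 ≤ I s := fun s => intΩ_nonneg fun x y => by positivity
  obtain ⟨s, hs, hmax⟩ := isCompact_Icc.exists_isMaxOn (Set.nonempty_Icc.2 ht0)
    (vort_cont S).continuousOn
  set m := omegaL4 S s with hm
  have hm0 : 0 ≤ m := Real.rpow_nonneg (hI0 s) _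
  have hm4 : m ^ 4 = I s := rpow_quarter (hI0 s)
  have hIm : ∀ t ∈ Icc 0 t0, I t ≤ m ^ 4 := fun t ht => by rw [hm4]; exact hmax ht
  have hle : omegaL4 S t0 ≤ m :=
    Real.rpow_le_rpow (hI0 t0) (hmax (right_mem_Icc.2 ht0)) (by norm_num)
  refine hle.trans ?_
  -- a priori estimate for any boundary bound
  have key : ∀ Λ : ℝ, 0 ≤ Λ → (∀ t ∈ Icc 0 t0, ∀ x, |vort S t x 0| ≤ Λ) →
      (∀ t ∈ Icc 0 t0, ∀ x, |vort S t x 1| ≤ Λ) → m ≤ C1 * (D + Λ) := by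
    intro Λ hΛ h0 h1
    have h := vort_trunc hΓ hRa hPr S hT hΛ h0 h1 s hs
    refine m_bound hΓ hW hRa hΛ hm0 (vort0_le S) ?_
    rw [hm4]; exact h
  set μ := max 1 α with hμ
  have hμ1 : 1 ≤ μ := le_max_left _ _
  have hμα : α ≤ μ := le_max_right _ _
  have hμ3 : max 1 (α ^ 3) = μ ^ 3 := by
    rcases le_total α 1 with h | h
    · rw [hμ, max_eq_left h, max_eq_left (pow_le_one₀ hα h)]; norm_num
    · rw [hμ, max_eq_right h, max_eq_right (one_le_pow₀ h)]
  rw [hμ3]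
  have hμ31 : 1 ≤ μ ^ 3 := one_le_pow₀ hμ1
  have hcst : cst Γ = 3 * C1 + 6 * C1 * (40 * (1 + Γ)) * (37 * C1 ^ 2) / R0 := rfl
  rw [hcst]
  clear_value C1 R0 α W
  have hq : 0 ≤ 6 * C1 * (40 * (1 + Γ)) * (37 * C1 ^ 2) / R0 := by positivity
  rcases hα.eq_or_lt with ha0 | hap
  · -- free slip
    have h := key 0 le_rfl (fun t ht x => by rw [hbot t x ht.1, ← ha0]; simp)
      (fun t ht x => by rw [htop t x ht.1, ← ha0]; simp)
    rw [add_zero] at h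
    refine h.trans ?_
    have h2 : C1 ≤ (3 * C1 + 6 * C1 * (40 * (1 + Γ)) * (37 * C1 ^ 2) / R0) * μ ^ 3 := by
      nlinarith
    exact mul_le_mul_of_nonneg_right h2 hD0.le
  · set β := min 1 α with hβ
    have hβ0 : 0 < β := lt_min one_pos hap
    have hβ1 : β ≤ 1 := min_le_left _ _
    have hβα : β ≤ α := min_le_right _ _
    have hμβ : α / β = μ := by
      rw [div_eq_iff hβ0.ne', hμ, hβ, max_mul_min, one_mul]
    set E := 40 * (1 + Γ) * D / β with hE
    have hE0 : 0 < E := by positivity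
    have hEe : ∀ t ∈ Icc 0 t0, intΩ Γ (fun x y => S.u1 t x y ^ 2) ≤ E ^ 2 := by
      intro t ht
      have h1 := hen β hβ0 hβ1 hβα t ht.1
      have h2 := energy0_le hΓ hRa S
      rw [← hWd, ← hD] at h2
      have h3 : intΩ Γ (fun x y => S.u1 t x y ^ 2) ≤
          intΩ Γ (fun x y => S.u1 t x y ^ 2 + S.u2 t x y ^ 2) :=
        intΩ_mono ((S.smooth_u1.c2 t).pow 2) (ucont S t)
          (fun x y _ => by nlinarith [sq_nonneg (S.u2 t x y)])
      have h4 : 32 * Γ * Ra ^ 2 / β ≤ 32 * Γ * D ^ 2 / β ^ 2 := by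
        have : Ra ^ 2 ≤ D ^ 2 := pow_le_pow_left₀ hRa.le (by linarith) 2
        have h5 : β ^ 2 ≤ β := by nlinarith
        exact div_le_div₀ (by positivity) (mul_le_mul_of_nonneg_left this (by positivity))
          (by positivity) h5
      have h6 : (1 + Γ) * D ^ 2 ≤ (1 + Γ) * D ^ 2 / β ^ 2 := by
        rw [le_div_iff₀ (by positivity)]
        have : β ^ 2 ≤ 1 := pow_le_one₀ hβ0.le hβ1
        have h7 : 0 ≤ (1 + Γ) * D ^ 2 := by positivity
        nlinarith
      have h8 : E ^ 2 = 1600 * (1 + Γ) ^ 2 * D ^ 2 / β ^ 2 := by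
        rw [hE, div_pow]; ring
      have h9 : (1 + Γ) * D ^ 2 / β ^ 2 + 32 * Γ * D ^ 2 / β ^ 2 ≤ E ^ 2 := by
        rw [h8, ← add_div]
        refine div_le_div_of_nonneg_right ?_ (by positivity)
        have : 0 ≤ D ^ 2 := by positivity
        have h10 : (1 + Γ) + 32 * Γ ≤ 1600 * (1 + Γ) ^ 2 := by nlinarith
        calc _ = ((1 + Γ) + 32 * Γ) * D ^ 2 := by ring
          _ ≤ _ := mul_le_mul_of_nonneg_right h10 this
      linarith
    set q := 1 + (6 * C1 * α) ^ 2 with hqd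
    have hq1 : 1 ≤ q := by rw [hqd]; nlinarith [sq_nonneg (6 * C1 * α)]
    set R := R0 / q with hR
    have hRp : 0 < R := by positivity
    have hRR0 : R ≤ R0 := div_le_self hR0p.le hq1
    have hR1 : R ≤ 1 := hRR0.trans hR01
    have hR2 : R ≤ Γ / 2 := hRR0.trans hR02
    have hsR : 6 * C1 * α * Real.sqrt R ≤ 1 := by
      have h1 : (6 * C1 * α * Real.sqrt R) ^ 2 ≤ 1 := by
        rw [mul_pow, Real.sq_sqrt hRp.le, hR, ← mul_div_assoc, div_le_one (by positivity)]
        nlinarith [sq_nonneg (6 * C1 * α)]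
      exact (abs_le_one_iff_mul_self_le_one.2 (by rw [← sq]; exact h1) |> le_of_abs_le)
    set M := m + Ra with hM
    have hM0 : 0 < M := by linarith
    have hMi : ∀ t ∈ Icc 0 t0, intΩ Γ (fun x y => (d1 S.u2 t x y - d2 S.u1 t x y) ^ 4) ≤ M ^ 4 :=
      fun t ht => (hIm t ht).trans (pow_le_pow_left₀ hm0 (by linarith) 4)
    set B := 3 * (E / R + M * Real.sqrt R) with hB
    have hB0 : 0 ≤ B := by positivity
    have h := key (α * B) (by positivity)
      (fun t ht x => by
        rw [hbot t x ht.1, abs_neg, abs_mul, abs_of_nonneg hα]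
        exact mul_le_mul_of_nonneg_left (bdry_bound S.smooth_u1 S.smooth_u2 S.periodic_u1
          S.periodic_u2 t (fun x y hy => S.incomp t x y ht.1 hy) (fun x => S.u2_bot t x ht.1)
          hRp hR1 hR2 hE0 hM0 (hEe t ht) (hMi t ht) x) hα)
      (fun t ht x => by
        rw [htop t x ht.1, abs_mul, abs_of_nonneg hα]
        exact mul_le_mul_of_nonneg_left (bdry_bound_top S.smooth_u1 S.smooth_u2 S.periodic_u1
          S.periodic_u2 t (fun x y hy => S.incomp t x y ht.1 hy) (fun x => S.u2_top t x ht.1)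
          hRp hR1 hR2 hE0 hM0 (hEe t ht) (hMi t ht) x) hα)
    have h1 : C1 * (α * B) = 3 * C1 * (α * E / R) + (6 * C1 * α * Real.sqrt R) * M / 2 := by
      rw [hB]; ring
    have h2 : (6 * C1 * α * Real.sqrt R) * M ≤ 1 * M := mul_le_mul_of_nonneg_right hsR hM0.le
    have h3 : m ≤ 3 * C1 * D + 6 * C1 * (α * E / R) := by
      have : Ra ≤ C1 * D := by nlinarith
      nlinarith
    have h4 : α * E / R = 40 * (1 + Γ) * D * μ * q / R0 := by
      rw [hE, hR, ← hμβ]; field_simp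
    have h5 : q ≤ 37 * C1 ^ 2 * μ ^ 2 := by
      rw [hqd]
      have h6 : α ^ 2 ≤ μ ^ 2 := pow_le_pow_left₀ hα hμα 2
      have h7 : 1 ≤ C1 ^ 2 * μ ^ 2 := by
        have := one_le_pow₀ (n := 2) hC1p
        have := one_le_pow₀ (n := 2) hμ1
        nlinarith
      have h8 : C1 ^ 2 * α ^ 2 ≤ C1 ^ 2 * μ ^ 2 := mul_le_mul_of_nonneg_left h6 (by positivity)
      nlinarith
    have h6 : α * E / R ≤ 40 * (1 + Γ) * D * μ * (37 * C1 ^ 2 * μ ^ 2) / R0 := by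
      rw [h4]
      refine div_le_div_of_nonneg_right (mul_le_mul_of_nonneg_left h5 (by positivity)) hR0p.le
    have h7 : 3 * C1 * D ≤ 3 * C1 * μ ^ 3 * D := by
      have : 0 ≤ 3 * C1 * D := by positivity
      nlinarith
    have h8 : (3 * C1 + 6 * C1 * (40 * (1 + Γ)) * (37 * C1 ^ 2) / R0) * μ ^ 3 * D =
        3 * C1 * μ ^ 3 * D +
        6 * C1 * (40 * (1 + Γ) * D * μ * (37 * C1 ^ 2 * μ ^ 2) / R0) := by ring
    rw [h8]
    have h9 : 6 * C1 * (α * E / R) ≤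
        6 * C1 * (40 * (1 + Γ) * D * μ * (37 * C1 ^ 2 * μ ^ 2) / R0) :=
      mul_le_mul_of_nonneg_left h6 (by positivity)
    linarith

lemma cst_pos (hΓ : 0 < Γ) : 0 < cst Γ := by
  have : 0 < min 1 (Γ / 2) := lt_min one_pos (by linarith)
  unfold cst
  positivity

/-- enstrophy, uniform-in-time bound
‖ω(t)‖_{L⁴} ≤ C max{1, Ls⁻³} (‖u₀‖_{W^{1,4}} + Ra). -/
theorem enstrophy_uniform_bound (Γ : ℝ) (hΓ : 0 < Γ) :
    ∃ C : ℝ, 0 < C ∧ ∀ (Ra Pr : ℝ) (Ls : ℝ≥0∞), 0 < Ra → 0 < Pr → Ls ≠ 0 →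
      ∀ S : Sol Γ Ra Pr Ls, T0cond S → ∀ t : ℝ, 0 ≤ t →
        omegaL4 S t ≤ C * max 1 ((Ls⁻¹).toReal ^ 3) * (W14u0 S + Ra) := by
  exact ⟨cst Γ, cst_pos hΓ, fun Ra Pr Ls hRa hPr _ S hT t ht => main_bound hΓ hRa hPr S hT t ht⟩

end RB
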